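/- arXiv:math/0501048 — 3 statements merged into one kernel-verified Lean document; each statement's English description precedes it below -/
import Mathlib

section
/- For every p with 1 ≤ p < ∞, the space ℓp is prime: every infinite-dimensional complemented closed subspace of ℓp is topologically isomorphic to ℓp. -/
open scoped ENNReal

namespace lp

theorem norm_rpow_extend {α β V : Type*} [NormedAddCommGroup V] {q : ℝ} (hq : 0 < q)
    (i : α → β) (f : α → V) :
    (fun b => ‖Function.extend i f 0 b‖ ^ q) = Function.extend i (fun a => ‖f a‖ ^ q) 0 := by
  ext b
  by_cases h : ∃ a, i a = b
  · simp only [Function.extend, h, dite_true]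
  · simp [Function.extend_apply' _ _ _ h, Real.zero_rpow hq.ne']

section Reindex

variable {α β V : Type*} [NormedAddCommGroup V] [NormedSpace ℝ V] {p : ℝ≥0∞} [hp1 : Fact (1 ≤ p)]

theorem toReal_pos_of_ne_top (hp : p ≠ ∞) : 0 < p.toReal :=
  ENNReal.toReal_pos (zero_lt_one.trans_le hp1.out).ne' hp

/-- Precomposition with an injective map, as a contraction between `ℓp` spaces. -/
noncomputable def compCLM (hp : p ≠ ∞) {i : α → β} (hi : i.Injective) :
    lp (fun _ : β => V) p →L[ℝ] lp (fun _ : α => V) p :=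
  LinearMap.mkContinuous
    { toFun f := ⟨fun a => f (i a), memℓp_gen
        (((lp.memℓp f).summable (toReal_pos_of_ne_top hp)).comp_injective hi)⟩
      map_add' _ _ := rfl
      map_smul' _ _ := rfl }
    1 fun f => by
      have hq := toReal_pos_of_ne_top hp
      rw [one_mul]
      refine norm_le_of_tsum_le hq (norm_nonneg _) ?_
      rw [norm_rpow_eq_tsum hq f]
      exact tsum_comp_le_tsum_of_inj ((lp.memℓp f).summable hq) (fun _ => by positivity) hi

@[simp]
theorem compCLM_apply (hp : p ≠ ∞) {i : α → β} (hi : i.Injective)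
    (f : lp (fun _ : β => V) p) (a : α) : compCLM hp hi f a = f (i a) := rfl

/-- Extension by zero along an injective map, as a contraction between `ℓp` spaces. -/
noncomputable def extendCLM (hp : p ≠ ∞) {i : α → β} (hi : i.Injective) :
    lp (fun _ : α => V) p →L[ℝ] lp (fun _ : β => V) p :=
  LinearMap.mkContinuous
    { toFun f := ⟨Function.extend i f 0, memℓp_gen (by
        have hq := toReal_pos_of_ne_top hp
        rw [norm_rpow_extend hq, summable_extend_zero hi]
        exact (lp.memℓp f).summable hq)⟩
      map_add' f g := Subtype.ext <| by
        simpa using! Function.extend_add i (f : α → V) g 0 0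
      map_smul' c f := Subtype.ext <| by
        simpa using! Function.extend_smul c i (f : α → V) 0 }
    1 fun f => by
      have hq := toReal_pos_of_ne_top hp
      rw [one_mul]
      refine norm_le_of_tsum_le hq (norm_nonneg _) ?_
      simp only [LinearMap.coe_mk, AddHom.coe_mk]
      rw [norm_rpow_extend hq, tsum_extend_zero hi, norm_rpow_eq_tsum hq f]

@[simp]
theorem extendCLM_apply (hp : p ≠ ∞) {i : α → β} (hi : i.Injective)
    (f : lp (fun _ : α => V) p) (a : α) : extendCLM hp hi f (i a) = f a :=
  hi.extend_apply _ _ _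

theorem extendCLM_apply_of_notMem_range (hp : p ≠ ∞) {i : α → β} (hi : i.Injective)
    (f : lp (fun _ : α => V) p) {b : β} (hb : ∀ a, i a ≠ b) : extendCLM hp hi f b = 0 :=
  Function.extend_apply' _ _ _ (by simpa using hb)

theorem norm_extendCLM_le (hp : p ≠ ∞) {i : α → β} (hi : i.Injective) :
    ‖extendCLM (V := V) hp hi‖ ≤ 1 :=
  LinearMap.mkContinuous_norm_le _ zero_le_one _

/-- Reindexing `ℓp` along an equivalence. -/
noncomputable def reindexCLE (hp : p ≠ ∞) (e : α ≃ β) :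
    lp (fun _ : α => V) p ≃L[ℝ] lp (fun _ : β => V) p :=
  .equivOfInverse (compCLM hp e.symm.injective) (compCLM hp e.injective)
    (fun f => by ext; simp) (fun f => by ext; simp)

variable (V) in
/-- The isometry between `ℓp (α × β)` and `ℓp (α, ℓp β)`. -/
noncomputable def curryLIE (hp : p ≠ ∞) :
    lp (fun _ : α × β => V) p ≃ₗᵢ[ℝ] lp (fun _ : α => lp (fun _ : β => V) p) p :=
  have hq := toReal_pos_of_ne_top hp
  have key (f : lp (fun _ : α × β => V) p) (a : α) :
      ‖compCLM hp (Prod.mk_right_injective a) f‖ ^ p.toReal =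
        ∑' b, ‖f (a, b)‖ ^ p.toReal := norm_rpow_eq_tsum hq _
  have nonneg (f : α × β → V) : 0 ≤ fun x => ‖f x‖ ^ p.toReal := fun _ => by positivity
  { toFun f := ⟨fun a => compCLM hp (Prod.mk_right_injective a) f, memℓp_gen (by
      simp_rw [key]
      exact ((summable_prod_of_nonneg (nonneg f)).1 ((lp.memℓp f).summable hq)).2)⟩
    map_add' _ _ := rfl
    map_smul' _ _ := rfl
    invFun F := ⟨fun x => F x.1 x.2, memℓp_gen (by
      rw [summable_prod_of_nonneg (nonneg fun x => F x.1 x.2)]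
      refine ⟨fun a => (lp.memℓp (F a)).summable hq, ?_⟩
      simp_rw [← norm_rpow_eq_tsum hq]
      exact (lp.memℓp F).summable hq)⟩
    left_inv _ := rfl
    right_inv _ := rfl
    norm_map' f := by
      have h := (lp.memℓp f).summable hq
      rw [norm_eq_tsum_rpow hq, norm_eq_tsum_rpow hq f, h.tsum_prod]
      simp_rw [← key]
      rfl }

end Reindex

section Swindle

variable {M X : Type*} [NormedAddCommGroup M] [NormedSpace ℝ M] [NormedAddCommGroup X]
  [NormedSpace ℝ X] {p : ℝ≥0∞} [Fact (1 ≤ p)]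

/-- The Eilenberg swindle: a complemented subspace of `X` is absorbed by `ℓp(X)`. -/
noncomputable def swindleCLE (hp : p ≠ ∞) (i : M →L[ℝ] X) (r : X →L[ℝ] M)
    (h : Function.LeftInverse r i) :
    (M × lp (fun _ : ℕ => X) p) ≃L[ℝ] lp (fun _ : ℕ => X) p :=
  let D : lp (fun _ : ℕ => X) p →L[ℝ] lp (fun _ : ℕ => X) p :=
    mapCLM p (fun _ => i.comp r) (norm_nonneg _) fun _ => le_rfl
  let R : lp (fun _ : ℕ => X) p →L[ℝ] lp (fun _ : ℕ => X) p :=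
    extendCLM hp Nat.succ_injective
  let L : lp (fun _ : ℕ => X) p →L[ℝ] lp (fun _ : ℕ => X) p :=
    compCLM hp Nat.succ_injective
  have hR0 (f) : R f 0 = 0 := extendCLM_apply_of_notMem_range hp _ f fun _ => Nat.succ_ne_zero _
  have hRs (f) (n) : R f (n + 1) = f n := extendCLM_apply hp Nat.succ_injective f n
  have hL (f) (n) : L f n = f (n + 1) := rfl
  have hD (f) (n) : D f n = i (r (f n)) := rfl
  have hS (x) (n) : lp.single (E := fun _ : ℕ => X) p 0 x (n + 1) = 0 :=
    lp.single_apply_ne _ _ _ n.succ_ne_zero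
  .equivOfInverse
    (((singleContinuousLinearMap ℝ (fun _ : ℕ => X) p 0).comp i).coprod (.id ℝ _ - D + R.comp D))
    ((r.comp (evalCLM ℝ (fun _ : ℕ => X) p 0)).prod (.id ℝ _ - D + D.comp L))
    (fun ⟨m, x⟩ => by
      ext n
      · simp [evalCLM, hD, hR0, h _]
      · cases n <;> simp [hD, hR0, hRs, hL, h _])
    (fun y => by
      ext n
      cases n <;> simp [evalCLM, hD, hR0, hRs, hL, h _])

end Swindle

theorem sum_range_single_apply {p : ℝ≥0∞} (f : lp (fun _ : ℕ => ℝ) p) (N n : ℕ) :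
    (∑ i ∈ Finset.range N, lp.single p i (f i) : lp (fun _ : ℕ => ℝ) p) n =
      if n < N then f n else 0 := by
  rw [coeFn_sum, Finset.sum_apply]
  simp [Pi.single_apply]

section Subspace

variable {p : ℝ≥0∞} [hp1 : Fact (1 ≤ p)]

/-- Restriction of a sequence to the fibres of `b`, as a contraction into `ℓp(ℓp)`. -/
noncomputable def fiberCLM (hp : p ≠ ∞) (b : ℕ → ℕ) :
    lp (fun _ : ℕ => ℝ) p →L[ℝ] lp (fun _ : ℕ => lp (fun _ : ℕ => ℝ) p) p :=
  (curryLIE ℝ hp).toContinuousLinearEquiv.toContinuousLinearMap.comp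
    (extendCLM hp (i := fun n => (b n, n)) fun _ _ h => congrArg Prod.snd h)

theorem fiberCLM_apply (hp : p ≠ ∞) (b : ℕ → ℕ) (f : lp (fun _ : ℕ => ℝ) p) (k n : ℕ) :
    fiberCLM hp b f k n = if b n = k then f n else 0 := by
  have hi : Function.Injective fun n => (b n, n) := fun _ _ h => congrArg Prod.snd h
  change extendCLM hp hi f (k, n) = _
  split_ifs with h
  · subst h
    exact extendCLM_apply hp hi f n
  · refine extendCLM_apply_of_notMem_range hp hi f fun m hm => h ?_
    simp only [Prod.mk.injEq] at hm
    rw [← hm.2, hm.1]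

theorem norm_fiberCLM_le (hp : p ≠ ∞) (b : ℕ → ℕ) : ‖fiberCLM hp b‖ ≤ 1 := by
  refine ContinuousLinearMap.opNorm_le_bound _ zero_le_one fun f => ?_
  have h := (extendCLM (V := ℝ) hp (i := fun n => (b n, n)) fun _ _ h =>
    congrArg Prod.snd h).le_of_opNorm_le (norm_extendCLM_le hp _) f
  exact ((curryLIE ℝ hp).norm_map _).le.trans h

/-- Gluing a sequence of sequences along the fibres of `b`. -/
noncomputable def glueCLM (hp : p ≠ ∞) (b : ℕ → ℕ) :
    lp (fun _ : ℕ => lp (fun _ : ℕ => ℝ) p) p →L[ℝ] lp (fun _ : ℕ => ℝ) p :=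
  (compCLM hp (i := fun n => (b n, n)) fun _ _ h => congrArg Prod.snd h).comp
    (curryLIE ℝ hp).symm.toContinuousLinearEquiv.toContinuousLinearMap

theorem norm_sub_sum_single_tendsto (hp : p ≠ ∞) (f : lp (fun _ : ℕ => ℝ) p) :
    Filter.Tendsto (fun N => ‖f - ∑ i ∈ Finset.range N, lp.single p i (f i)‖)
      Filter.atTop (nhds 0) := by
  simpa using ((lp.hasSum_single hp f).tendsto_sum_nat.const_sub f).norm

theorem exists_mem_norm_eq_one_forall_lt_eq_zero {M : Submodule ℝ (lp (fun _ : ℕ => ℝ) p)}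
    (hinf : ¬ FiniteDimensional ℝ M) (N : ℕ) :
    ∃ m ∈ M, ‖m‖ = 1 ∧ ∀ i < N, m i = 0 := by
  let T : M →ₗ[ℝ] (Fin N → ℝ) := LinearMap.pi fun i => (evalₗ _ p (i : ℕ)).comp M.subtype
  have hT : ¬ Function.Injective T := fun h => hinf (FiniteDimensional.of_injective T h)
  rw [← LinearMap.ker_eq_bot, Submodule.eq_bot_iff] at hT
  push Not at hT
  obtain ⟨m, hm, hm0⟩ := hT
  have hm0' : (m : lp (fun _ : ℕ => ℝ) p) ≠ 0 := by simpa using hm0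
  refine ⟨‖(m : lp (fun _ : ℕ => ℝ) p)‖⁻¹ • m, M.smul_mem _ m.2, ?_, fun i hi => ?_⟩
  · rw [norm_smul, norm_inv, norm_norm, inv_mul_cancel₀ (norm_ne_zero_iff.2 hm0')]
  · have : T m ⟨i, hi⟩ = 0 := by rw [LinearMap.mem_ker.1 hm]; rfl
    have : (m : lp (fun _ : ℕ => ℝ) p) i = 0 := this
    simp [this]

/-- An infinite-dimensional subspace of `ℓp` contains normalized sequences that are as close as
desired to their restrictions to pairwise disjoint blocks. -/
theorem exists_almost_disjoint (hp : p ≠ ∞) {M : Submodule ℝ (lp (fun _ : ℕ => ℝ) p)}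
    (hinf : ¬ FiniteDimensional ℝ M) {ε : ℕ → ℝ} (hε : ∀ k, 0 < ε k) :
    ∃ (m : ℕ → lp (fun _ : ℕ => ℝ) p) (b : ℕ → ℕ), ∀ k, m k ∈ M ∧ ‖m k‖ = 1 ∧
      ‖m k - fiberCLM hp b (m k) k‖ ≤ ε k := by
  have step (N k : ℕ) : ∃ (m : lp (fun _ : ℕ => ℝ) p) (N' : ℕ), N < N' ∧ m ∈ M ∧ ‖m‖ = 1 ∧
      (∀ i < N, m i = 0) ∧ ‖m - ∑ i ∈ Finset.range N', lp.single p i (m i)‖ ≤ ε k := by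
    obtain ⟨m, hmM, hm1, hm0⟩ := exists_mem_norm_eq_one_forall_lt_eq_zero hinf N
    obtain ⟨N', hN', hlt⟩ := (((norm_sub_sum_single_tendsto hp m).eventually_lt_const
      (hε k)).and (Filter.eventually_gt_atTop N)).exists
    exact ⟨m, N', hlt, hmM, hm1, hm0, hN'.le⟩
  choose m N hlt hM h1 h0 hclose using step
  let s : ℕ → ℕ := fun k => Nat.rec 0 (fun k Nk => N Nk k) k
  have hs : StrictMono s := strictMono_nat_of_lt_succ fun k => hlt (s k) k
  have hex (i : ℕ) : ∃ k, i < s (k + 1) := ⟨i, hs.id_le (i + 1)⟩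
  refine ⟨fun k => m (s k) k, fun i => Nat.find (hex i), fun k => ⟨hM _ _, h1 _ _, ?_⟩⟩
  convert hclose (s k) k using 3
  ext i
  rw [fiberCLM_apply, sum_range_single_apply]
  change _ = if i < s (k + 1) then _ else _
  by_cases hi : i < s (k + 1)
  · rw [if_pos hi]
    split_ifs with hb
    · rfl
    · have hb' : Nat.find (hex i) < k := lt_of_le_of_ne (Nat.find_min' _ hi) hb
      exact (h0 _ _ i ((Nat.find_spec (hex i)).trans_le (hs.monotone hb'))).symm
  · rw [if_neg hi, if_neg]
    rintro rfl
    exact hi (Nat.find_spec (hex i))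

/-- Every infinite-dimensional closed subspace of `ℓp` contains a copy of `ℓp` that is
complemented in `ℓp`. -/
theorem exists_leftInverse_of_not_finiteDimensional (hp : p ≠ ∞)
    {M : Submodule ℝ (lp (fun _ : ℕ => ℝ) p)} (hclosed : IsClosed (M : Set (lp (fun _ : ℕ => ℝ) p)))
    (hinf : ¬ FiniteDimensional ℝ M) :
    ∃ (A : lp (fun _ : ℕ => ℝ) p →L[ℝ] M) (C : lp (fun _ : ℕ => ℝ) p →L[ℝ] lp (fun _ : ℕ => ℝ) p),
      ∀ x, C (A x) = x := by
  let X := lp (fun _ : ℕ => ℝ) p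
  let ε : ℕ → ℝ := fun k => 1 / 8 * (1 / 2) ^ k
  have hε (k) : 0 < ε k := by positivity
  have hεsum : HasSum ε (1 / 4) := by
    have h := hasSum_geometric_two.mul_left (1 / 8 : ℝ)
    rwa [show (1 / 8 * 2 : ℝ) = 1 / 4 by norm_num] at h
  have hε4 (k) : ε k ≤ 1 / 4 := le_hasSum hεsum k fun j _ => (hε j).le
  obtain ⟨m, b, hmb⟩ := exists_almost_disjoint hp hinf hε
  choose hmM hm1 hmε using hmb
  let u : ℕ → X := fun k => fiberCLM hp b (m k) k
  choose ψ hψ1 hψu using fun k => exists_dual_vector'' ℝ (u k)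
  -- the block operator, its perturbation by the tails of the `m k`, and the coordinate operator
  let U : X →L[ℝ] X := (glueCLM hp b).comp
    (mapCLM p (fun k => ContinuousLinearMap.toSpanSingleton ℝ (m k)) zero_le_one
      fun k => by simp [hm1])
  let e : ℕ → X →L[ℝ] X := fun k => (evalCLM ℝ (fun _ => ℝ) p k).smulRight (m k - u k)
  have heval (k) : ‖evalCLM ℝ (fun _ : ℕ => ℝ) p k‖ ≤ 1 :=
    LinearMap.mkContinuous_norm_le _ zero_le_one _
  have he (k) : ‖e k‖ ≤ ε k := by
    rw [ContinuousLinearMap.norm_smulRight_apply]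
    exact (mul_le_mul (heval k) (hmε k) (norm_nonneg _) zero_le_one).trans_eq (one_mul _)
  have hesum : Summable e := .of_norm_bounded hεsum.summable he
  let E : X →L[ℝ] X := ∑' k, e k
  have hE : ‖E‖ ≤ 1 / 4 := tsum_of_norm_bounded hεsum he
  let C : X →L[ℝ] X := (mapCLM p ψ zero_le_one hψ1).comp (fiberCLM hp b)
  have hC : ‖C‖ ≤ 1 := by
    refine (ContinuousLinearMap.opNorm_comp_le _ _).trans ?_
    exact mul_le_one₀ (norm_mapCLM_le _ _ _ _) (norm_nonneg _) (norm_fiberCLM_le hp b)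
  have hAsingle (k : ℕ) (c : ℝ) : (U + E) (lp.single p k c) = c • m k := by
    have h1 : U (lp.single p k c) = c • u k := by
      ext n
      change lp.single (E := fun _ : ℕ => ℝ) p k c (b n) * m (b n) n = c * fiberCLM hp b (m k) k n
      rw [fiberCLM_apply, lp.single_apply]
      by_cases hb : b n = k <;> simp [hb]
    have h2 : E (lp.single p k c) = c • (m k - u k) := by
      rw [show E (lp.single p k c) = ∑' j, e j (lp.single p k c) from
        ((ContinuousLinearMap.apply ℝ X (lp.single (E := fun _ : ℕ => ℝ) p k c)).map_tsum
          hesum), tsum_eq_single k]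
      · change lp.single (E := fun _ : ℕ => ℝ) p k c k • (m k - u k) = _
        rw [lp.single_apply_self]
      · intro j hj
        change lp.single (E := fun _ : ℕ => ℝ) p k c j • (m j - u j) = _
        rw [lp.single_apply_ne _ _ _ hj, zero_smul]
    rw [add_apply, h1, h2, smul_sub, add_sub_cancel]
  have hAM (x : X) : (U + E) x ∈ M := by
    refine hclosed.mem_of_tendsto ((lp.hasSum_single hp x).mapL (U + E)) (.of_forall fun s => ?_)
    exact M.sum_mem fun k _ => by
      rw [hAsingle]
      exact M.smul_mem _ (hmM k)
  let D : X →L[ℝ] X := mapCLM p (fun k => (1 - ‖u k‖) • ContinuousLinearMap.id ℝ ℝ)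
    (by norm_num : (0 : ℝ) ≤ 1 / 4) fun k => by
      rw [norm_smul, ContinuousLinearMap.norm_id, mul_one]
      nth_rw 1 [← hm1 k]
      exact ((abs_norm_sub_norm_le _ _).trans (hmε k)).trans (hε4 k)
  have hCU : 1 - C.comp U = D := by
    ext x k
    have hu : fiberCLM hp b (U x) k = x k • u k := by
      ext n
      rw [fiberCLM_apply]
      change (if b n = k then x (b n) * m (b n) n else 0) = x k * fiberCLM hp b (m k) k n
      rw [fiberCLM_apply]
      split_ifs with hb
      · rw [hb]
      · simp
    change x k - ψ k (fiberCLM hp b (U x) k) = (1 - ‖u k‖) * x k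
    rw [hu, map_smul, hψu]
    simp
    ring
  have hlt : ‖1 - C.comp (U + E)‖ < 1 := by
    have : 1 - C.comp (U + E) = D - C.comp E := by
      rw [ContinuousLinearMap.comp_add, ← hCU, sub_sub]
    rw [this]
    have h1 : ‖D‖ ≤ 1 / 4 := norm_mapCLM_le _ _ _ _
    have h2 : ‖C.comp E‖ ≤ 1 * (1 / 4) := (ContinuousLinearMap.opNorm_comp_le _ _).trans
      (mul_le_mul hC hE (norm_nonneg _) zero_le_one)
    linarith [norm_sub_le D (C.comp E)]
  obtain ⟨v, hv⟩ := isUnit_one_sub_of_norm_lt_one hlt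
  rw [sub_sub_cancel] at hv
  refine ⟨(U + E).codRestrict M hAM, (v⁻¹ : (X →L[ℝ] X)ˣ).1.comp C, fun x => ?_⟩
  have := congrArg (fun T : X →L[ℝ] X => T x) v.inv_mul
  rw [hv] at this
  exact this

end Subspace

end lp

/-- For `1 ≤ p < ∞`, the space `ℓp` is prime: every infinite-dimensional complemented
closed subspace of `ℓp` is topologically isomorphic to `ℓp`. -/
theorem lp_is_prime (p : ℝ≥0∞) [Fact (1 ≤ p)] (hp : p ≠ ∞)
    (M : Submodule ℝ (lp (fun _ : ℕ => ℝ) p))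
    (hclosed : IsClosed (M : Set (lp (fun _ : ℕ => ℝ) p)))
    (hinf : ¬ FiniteDimensional ℝ M) (hcompl : M.ClosedComplemented) :
    Nonempty (M ≃L[ℝ] lp (fun _ : ℕ => ℝ) p) := by
  let X := lp (fun _ : ℕ => ℝ) p
  obtain ⟨P, hP⟩ := hcompl
  obtain ⟨A, C, hCA⟩ := lp.exists_leftInverse_of_not_finiteDimensional hp hclosed hinf
  let c : X ≃L[ℝ] lp (fun _ : ℕ => X) p :=
    (lp.reindexCLE hp Nat.pairEquiv.symm).trans (lp.curryLIE ℝ hp).toContinuousLinearEquiv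
  have eM : (M × X) ≃L[ℝ] X := ((ContinuousLinearEquiv.refl ℝ M).prodCongr c).trans
    ((lp.swindleCLE hp M.subtypeL P hP).trans c.symm)
  have eX : (X × X) ≃L[ℝ] X := ((ContinuousLinearEquiv.refl ℝ X).prodCongr c).trans
    ((lp.swindleCLE hp (.id ℝ X) (.id ℝ X) fun _ => rfl).trans c.symm)
  let C' : M →L[ℝ] X := C.comp M.subtypeL
  have eW : M ≃L[ℝ] X × C'.ker := .equivOfRightInverse C' A hCA
  have absorb : M ≃L[ℝ] X × M :=
    eW.trans <| (eX.symm.prodCongr (.refl ℝ _)).trans <|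
      (ContinuousLinearEquiv.prodAssoc ℝ X X C'.ker).trans <|
        (ContinuousLinearEquiv.refl ℝ X).prodCongr eW.symm
  exact ⟨absorb.trans <| (ContinuousLinearEquiv.prodComm ℝ X M).trans eM⟩
end

section
/- Mackey's theorem: in a separable Banach space every closed subspace is quasi-complemented, i.e., for every closed subspace Y of a separable Banach space X there exists a closed subspace Z of X with Y ∩ Z = {0} and Y + Z dense in X. -/
/-- Given a bilinear pairing `p`, a subspace `A` disjoint from `Y` and a finite-dimensional
subspace `B` annihilating `A` whose points are separated by `Y`, one can enlarge `A`, keeping it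
disjoint from `Y` and annihilated by `B`, so that `A ⊔ Y` contains a prescribed vector. -/
theorem LinearMap.exists_le_disjoint_mem_sup
    {K V W : Type*} [Field K] [AddCommGroup V] [Module K V] [AddCommGroup W] [Module K W]
    (p : V →ₗ[K] W →ₗ[K] K) (Y A : Submodule K V) (B : Submodule K W)
    (hAfg : A.FG) (hBfg : B.FG) (hAY : Disjoint A Y)
    (hsep : ∀ b ∈ B, (∀ y ∈ Y, p y b = 0) → b = 0)
    (hAB : ∀ a ∈ A, ∀ b ∈ B, p a b = 0) (u : V) :
    ∃ A' : Submodule K V, A ≤ A' ∧ A'.FG ∧ Disjoint A' Y ∧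
      (∀ a ∈ A', ∀ b ∈ B, p a b = 0) ∧ u ∈ A' ⊔ Y := by
  by_cases hu : u ∈ A ⊔ Y
  · exact ⟨A, le_rfl, hAfg, hAY, hAB, hu⟩
  have : FiniteDimensional K B := Module.Finite.iff_fg.mpr hBfg
  have hsurj : Function.Surjective (p.domRestrict₁₂ Y B) := by
    refine (LinearMap.flip_surjective_iff₁ (B := (p.domRestrict₁₂ Y B).flip)).mpr ?_
    rw [injective_iff_map_eq_zero]
    rintro ⟨b, hb⟩ h
    exact Subtype.ext (hsep b hb fun y hy => LinearMap.congr_fun h ⟨y, hy⟩)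
  obtain ⟨⟨y, hy⟩, hyu⟩ := hsurj (-((p u).domRestrict B))
  have hv : ∀ b ∈ B, p (u + y) b = 0 := by
    intro b hb
    have h : p y b = -p u b := LinearMap.congr_fun hyu ⟨b, hb⟩
    simp [h]
  have huy : u + y ∉ A ⊔ Y := fun h => hu <| by
    simpa using Submodule.sub_mem _ h (Submodule.mem_sup_right hy)
  refine ⟨A ⊔ K ∙ (u + y), le_sup_left, hAfg.sup (Submodule.fg_span_singleton _), ?_, ?_, ?_⟩
  · rw [Submodule.disjoint_def]
    intro x hx hxY
    obtain ⟨a, ha, w, hw, rfl⟩ := Submodule.mem_sup.mp hx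
    obtain ⟨c, rfl⟩ := Submodule.mem_span_singleton.mp hw
    by_cases hc : c = 0
    · subst hc
      rw [zero_smul, add_zero] at hxY ⊢
      exact Submodule.disjoint_def.mp hAY a ha hxY
    · refine absurd ?_ huy
      rw [← Submodule.smul_mem_iff _ hc]
      simpa using Submodule.sub_mem _ (Submodule.mem_sup_right hxY) (Submodule.mem_sup_left ha)
  · intro x hx b hb
    obtain ⟨a, ha, w, hw, rfl⟩ := Submodule.mem_sup.mp hx
    obtain ⟨c, rfl⟩ := Submodule.mem_span_singleton.mp hw
    rw [map_add, map_smul, LinearMap.add_apply, LinearMap.smul_apply, hAB a ha b hb, hv b hb]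
    simp
  · have h1 : u + y ∈ (A ⊔ K ∙ (u + y)) ⊔ Y :=
      Submodule.mem_sup_left (Submodule.mem_sup_right (Submodule.mem_span_singleton_self _))
    simpa using Submodule.sub_mem _ h1 (Submodule.mem_sup_right hy)

/-- A point outside a closed subspace is separated from it by a continuous functional vanishing
on the subspace. -/
theorem Submodule.exists_strongDual_ne_zero_of_notMem
    {X : Type*} [NormedAddCommGroup X] [NormedSpace ℝ X]
    {Y : Submodule ℝ X} (hY : IsClosed (Y : Set X)) {x : X} (hx : x ∉ Y) :
    ∃ f : StrongDual ℝ X, (∀ y ∈ Y, f y = 0) ∧ f x ≠ 0 := by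
  have : IsClosed (Y : Set X) := hY
  have hq : Y.mkQ x ≠ 0 := by simpa using hx
  obtain ⟨f, hf⟩ := SeparatingDual.exists_ne_zero (R := ℝ) hq
  refine ⟨f.comp Y.mkQL, fun y hy => ?_, hf⟩
  have : Y.mkQ y = 0 := by simpa using hy
  change f (Y.mkQ y) = 0
  rw [this, map_zero]

/-- The continuous dual of a separable normed space contains a sequence separating points. -/
theorem exists_seq_strongDual_separating
    (X : Type*) [NormedAddCommGroup X] [NormedSpace ℝ X] [TopologicalSpace.SeparableSpace X] :
    ∃ g : ℕ → StrongDual ℝ X, ∀ x, (∀ n, g n x = 0) → x = 0 := by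
  choose φ hφ hφx using fun x : X => exists_dual_vector'' ℝ x
  refine ⟨fun n => φ (TopologicalSpace.denseSeq X n), fun x hx => ?_⟩
  by_contra hne
  obtain ⟨n, hn⟩ := (TopologicalSpace.denseRange_denseSeq X).exists_dist_lt x
    (half_pos (norm_pos_iff.mpr hne))
  set u := TopologicalSpace.denseSeq X n
  have h1 : ‖u‖ ≤ ‖u - x‖ := by
    have h2 : φ u (u - x) = ‖u‖ := by
      rw [map_sub, hφx, hx n]
      simp
    calc ‖u‖ = φ u (u - x) := h2.symm
      _ ≤ ‖φ u (u - x)‖ := Real.le_norm_self _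
      _ ≤ 1 * ‖u - x‖ := (φ u).le_of_opNorm_le (hφ u) _
      _ = ‖u - x‖ := one_mul _
  have h3 : ‖x‖ ≤ ‖u‖ + ‖u - x‖ := by
    simpa using norm_sub_le u (u - x)
  rw [dist_comm, dist_eq_norm] at hn
  linarith

/-- Mackey's theorem: in a separable Banach space every closed subspace `Y` is
quasi-complemented: there is a closed subspace `Z` with `Y ⊓ Z = ⊥` and `Y + Z`
dense in `X`. -/
theorem mackey_quasi_complement
    {X : Type*} [NormedAddCommGroup X] [NormedSpace ℝ X] [CompleteSpace X]
    [TopologicalSpace.SeparableSpace X]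
    (Y : Submodule ℝ X) (hY : IsClosed (Y : Set X)) :
    ∃ Z : Submodule ℝ X, IsClosed (Z : Set X) ∧ Y ⊓ Z = ⊥ ∧
      Dense ((Y ⊔ Z : Submodule ℝ X) : Set X) := by
  obtain ⟨g, hg⟩ := exists_seq_strongDual_separating X
  let N : Submodule ℝ (StrongDual ℝ X) :=
    { carrier := {f | ∀ y ∈ Y, f y = 0}
      add_mem' := fun {a b} ha hb y hy => by simp [ha y hy, hb y hy]
      zero_mem' := fun y _ => rfl
      smul_mem' := fun c f hf y hy => by simp [hf y hy] }
  let p := topDualPairing ℝ X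
  -- finite-dimensional approximations of the quasi-complement and of its annihilator
  let S := {s : Submodule ℝ X × Submodule ℝ (StrongDual ℝ X) //
    s.1.FG ∧ s.2.FG ∧ Disjoint s.1 Y ∧ Disjoint s.2 N ∧ ∀ a ∈ s.1, ∀ b ∈ s.2, b a = 0}
  have step : ∀ (n : ℕ) (s : S), ∃ t : S, s.1.1 ≤ t.1.1 ∧ s.1.2 ≤ t.1.2 ∧
      TopologicalSpace.denseSeq X n ∈ t.1.1 ⊔ Y ∧ g n ∈ t.1.2 ⊔ N := by
    rintro n ⟨⟨A, B⟩, hA, hB, hAY, hBN, hAB⟩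
    obtain ⟨A', hAA', hA', hAY', hAB', hu⟩ := p.flip.exists_le_disjoint_mem_sup Y A B hA hB hAY
      (fun b hb h => Submodule.disjoint_def.mp hBN b hb h) hAB (TopologicalSpace.denseSeq X n)
    obtain ⟨B', hBB', hB', hBN', hBA', hgn⟩ := p.exists_le_disjoint_mem_sup N B A' hB hA' hBN
      (fun a ha h => by
        refine Submodule.disjoint_def.mp hAY' a ha ?_
        by_contra haY
        obtain ⟨f, hf, hfa⟩ := Submodule.exists_strongDual_ne_zero_of_notMem hY haY
        exact hfa (h f hf))
      (fun b hb a ha => hAB' a ha b hb) (g n)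
    exact ⟨⟨⟨A', B'⟩, hA', hB', hAY', hBN', fun a ha b hb => hBA' b hb a ha⟩,
      hAA', hBB', hu, hgn⟩
  choose next hnext₁ hnext₂ hnextu hnextg using step
  let s : ℕ → S := fun n => Nat.rec
    ⟨⟨⊥, ⊥⟩, Submodule.fg_bot, Submodule.fg_bot, disjoint_bot_left, disjoint_bot_left, by simp⟩
    (fun n t => next n t) n
  have hmono₁ : Monotone fun n => (s n).1.1 := monotone_nat_of_le_succ fun n => hnext₁ n (s n)
  have hmono₂ : Monotone fun n => (s n).1.2 := monotone_nat_of_le_succ fun n => hnext₂ n (s n)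
  have hker : ∀ n, ∀ b ∈ (s n).1.2,
      (⨆ m, (s m).1.1).topologicalClosure ≤ LinearMap.ker (b : X →ₗ[ℝ] ℝ) := by
    intro n b hb
    refine Submodule.topologicalClosure_minimal _ (iSup_le fun m a ha => ?_) b.isClosed_ker
    exact (s (max n m)).2.2.2.2.2 a (hmono₁ (le_max_right n m) ha) b
      (hmono₂ (le_max_left n m) hb)
  refine ⟨(⨆ m, (s m).1.1).topologicalClosure, Submodule.isClosed_topologicalClosure _, ?_, ?_⟩
  · rw [Submodule.eq_bot_iff]
    rintro z ⟨hzY, hzZ⟩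
    refine hg z fun n => ?_
    obtain ⟨b, hb, f, hf, hbf⟩ := Submodule.mem_sup.mp (hnextg n (s n))
    have hbz : b z = 0 := hker (n + 1) b hb hzZ
    rw [← hbf, add_apply, hbz, hf z hzY, add_zero]
  · refine (TopologicalSpace.denseRange_denseSeq X).mono ?_
    rintro _ ⟨n, rfl⟩
    have hle : (s (n + 1)).1.1 ⊔ Y ≤ Y ⊔ (⨆ m, (s m).1.1).topologicalClosure :=
      sup_le (le_sup_of_le_right ((le_iSup (fun m => (s m).1.1) (n + 1)).trans
        (Submodule.le_topologicalClosure _))) le_sup_left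
    exact hle (hnextu n (s n))
end

section
/- Rosenthal's theorem: every closed subspace of ℓ∞ is quasi-complemented, i.e., for every closed subspace Y of ℓ∞ there exists a closed subspace Z of ℓ∞ with Y ∩ Z = {0} and Y + Z dense in ℓ∞. -/
open scoped ENNReal

theorem ContinuousLinearMap.surjective_of_approx {E F : Type*} [NormedAddCommGroup E]
    [NormedSpace ℝ E] [CompleteSpace E] [NormedAddCommGroup F] [NormedSpace ℝ F]
    (T : E →L[ℝ] F) (C : ℝ) (h : ∀ y, ∃ x, ‖x‖ ≤ C * ‖y‖ ∧ ‖y - T x‖ ≤ ‖y‖ / 2) :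
    Function.Surjective T := by
  choose g hg hT using h
  intro y
  let r : ℕ → F := fun n => (fun z => z - T (g z))^[n] y
  have hr : ∀ n, r (n + 1) = r n - T (g (r n)) := fun n =>
    Function.iterate_succ_apply' _ _ _
  have hrn : ∀ n, ‖r n‖ ≤ (1 / 2) ^ n * ‖y‖ := by
    intro n
    induction n with
    | zero => simp [r]
    | succ k ih =>
      rw [hr, pow_succ]
      linarith [hT (r k)]
  have hC : ∀ n, ‖g (r n)‖ ≤ |C| * ‖y‖ * (1 / 2) ^ n := fun n => by
    calc ‖g (r n)‖ ≤ C * ‖r n‖ := hg _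
      _ ≤ |C| * ((1 / 2) ^ n * ‖y‖) :=
        mul_le_mul (le_abs_self C) (hrn n) (norm_nonneg _) (abs_nonneg _)
      _ = _ := by ring
  have hs : Summable fun n => g (r n) :=
    .of_norm_bounded (summable_geometric_two.mul_left _) hC
  have hsum : ∀ n, ∑ i ∈ Finset.range n, T (g (r i)) = y - r n := by
    intro n
    induction n with
    | zero => simp [r]
    | succ k ih => rw [Finset.sum_range_succ, ih, hr]; abel
  have hr0 : Filter.Tendsto r Filter.atTop (nhds 0) := by
    refine squeeze_zero_norm hrn ?_
    simpa using (tendsto_pow_atTop_nhds_zero_of_lt_one (r := (1 / 2 : ℝ)) (by norm_num)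
      (by norm_num)).mul_const ‖y‖
  have h1 := (T.hasSum hs.hasSum).tendsto_sum_nat
  simp only [hsum] at h1
  have h2 : Filter.Tendsto (fun n => y - r n) Filter.atTop (nhds (y - 0)) := hr0.const_sub y
  exact ⟨_, by simpa using tendsto_nhds_unique h1 h2⟩

theorem exists_hilbertBasis_nat (H : Type*) [NormedAddCommGroup H] [InnerProductSpace ℝ H]
    [CompleteSpace H] [TopologicalSpace.SeparableSpace H] (hH : ¬ FiniteDimensional ℝ H) :
    Nonempty (HilbertBasis ℕ ℝ H) := by
  obtain ⟨w, b, hb⟩ := exists_hilbertBasis ℝ H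
  have horth : ∀ i j : w, i ≠ j → 1 < dist (i : H) j := by
    intro i j hij
    have h0 := b.orthonormal.2 hij
    have hi := b.orthonormal.1 i
    have hj := b.orthonormal.1 j
    rw [hb] at h0 hi hj
    have := norm_sub_sq_real (i : H) j
    rw [hi, hj, h0] at this
    rw [dist_eq_norm]
    nlinarith [norm_nonneg ((i : H) - j)]
  have hcount : Countable w := by
    refine Pairwise.countable_of_isOpen_disjoint (s := fun i : w => Metric.ball (i : H) (1 / 2))
      ?_ (fun i => Metric.isOpen_ball) (fun i => ⟨i, by simp⟩)
    intro i j hij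
    exact Metric.ball_disjoint_ball (by linarith [horth i j hij])
  have hinf : Infinite w := by
    by_contra hfin
    rw [not_infinite_iff_finite] at hfin
    have := Fintype.ofFinite w
    exact hH b.toOrthonormalBasis.toBasis.finiteDimensional_of_finite
  obtain ⟨e⟩ := nonempty_equiv_of_countable (α := ℕ) (β := w)
  refine ⟨HilbertBasis.mk (v := b ∘ e) (b.orthonormal.comp e e.injective) ?_⟩
  rw [Set.range_comp, e.surjective.range_eq, Set.image_univ, b.dense_span]

theorem exists_denseRange_of_separable (E : Type*) [NormedAddCommGroup E] [NormedSpace ℝ E]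
    [CompleteSpace E] [TopologicalSpace.SeparableSpace E] :
    ∃ K : lp (fun _ : ℕ => ℝ) 2 →L[ℝ] E, DenseRange K := by
  let v : ℕ → E := fun n => ((1 / 2 : ℝ) ^ n / (1 + ‖TopologicalSpace.denseSeq E n‖)) •
    TopologicalSpace.denseSeq E n
  have hv : ∀ n, ‖v n‖ ≤ (1 / 2 : ℝ) ^ n := fun n => by
    have : 0 < 1 + ‖TopologicalSpace.denseSeq E n‖ := by positivity
    rw [norm_smul, Real.norm_of_nonneg (by positivity), div_mul_eq_mul_div, div_le_iff₀ this]
    gcongr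
    linarith
  let P : ℕ → lp (fun _ : ℕ => ℝ) 2 →L[ℝ] ℝ := fun n => lp.evalCLM ℝ (fun _ : ℕ => ℝ) 2 n
  have hP : ∀ n, ‖P n‖ ≤ 1 := fun n => by
    refine ContinuousLinearMap.opNorm_le_bound _ zero_le_one fun x => ?_
    rw [one_mul]
    exact lp.norm_apply_le_norm (by norm_num) x n
  have hs : Summable fun n => (P n).smulRight (v n) := by
    refine .of_norm_bounded summable_geometric_two fun n => ?_
    rw [ContinuousLinearMap.norm_smulRight_apply]
    calc ‖P n‖ * ‖v n‖ ≤ 1 * (1 / 2) ^ n := by gcongr; exacts [hP n, hv n]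
      _ = _ := one_mul _
  obtain ⟨K, hK⟩ := hs
  refine ⟨K, ?_⟩
  have hKv : ∀ n, K (lp.single 2 n 1) = v n := fun n => by
    have h1 := (ContinuousLinearMap.apply ℝ E (lp.single 2 n 1)).hasSum hK
    simp only [ContinuousLinearMap.apply_apply, ContinuousLinearMap.smulRight_apply] at h1
    have hP1 : P n (lp.single 2 n 1) = 1 := by simp [P, lp.evalCLM]
    have hP0 : ∀ m, m ≠ n → P m (lp.single 2 n 1) = 0 := fun m hm => by
      simp [P, lp.evalCLM, hm]
    rw [h1.unique (hasSum_single n fun m hm => by rw [hP0 m hm, zero_smul]), hP1, one_smul]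
  refine (TopologicalSpace.denseRange_denseSeq E).mono ?_
  rintro _ ⟨n, rfl⟩
  have : 0 < 1 + ‖TopologicalSpace.denseSeq E n‖ := by positivity
  refine ⟨((1 / 2 : ℝ) ^ n / (1 + ‖TopologicalSpace.denseSeq E n‖))⁻¹ • lp.single 2 n 1, ?_⟩
  rw [map_smul, hKv, inv_smul_smul₀ (by positivity)]

theorem exists_injective_denseRange (H E : Type*) [NormedAddCommGroup H] [InnerProductSpace ℝ H]
    [CompleteSpace H] [TopologicalSpace.SeparableSpace H] (hH : ¬ FiniteDimensional ℝ H)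
    [NormedAddCommGroup E] [NormedSpace ℝ E]
    [CompleteSpace E] [TopologicalSpace.SeparableSpace E] (hE : ¬ FiniteDimensional ℝ E) :
    ∃ K : H →L[ℝ] E, Function.Injective K ∧ DenseRange K := by
  obtain ⟨bH⟩ := exists_hilbertBasis_nat H hH
  obtain ⟨K, hK⟩ := exists_denseRange_of_separable E
  have hsep : TopologicalSpace.SeparableSpace (lp (fun _ : ℕ => ℝ) 2) :=
    bH.repr.surjective.denseRange.separableSpace bH.repr.continuous
  let N := K.ker
  have : CompleteSpace N := K.isClosed_ker.completeSpace_coe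
  let P := Nᗮ
  have hKP : DenseRange (K.comp P.subtypeL) := by
    refine hK.mono ?_
    rintro _ ⟨x, rfl⟩
    obtain ⟨n, hn, p, hp, rfl⟩ := N.exists_add_mem_mem_orthogonal x
    refine ⟨⟨p, hp⟩, ?_⟩
    have : K n = 0 := hn
    simp [this]
  have hP : ¬ FiniteDimensional ℝ P := fun hfin => hE <| by
    have hcl : IsClosed (Set.range (K.comp P.subtypeL)) :=
      Submodule.closed_of_finiteDimensional (LinearMap.range (K.comp P.subtypeL).toLinearMap)
    have : Function.Surjective (K.comp P.subtypeL) := by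
      rw [← Set.range_eq_univ, ← hcl.closure_eq, hKP.closure_range]
    exact Module.Finite.of_surjective (K.comp P.subtypeL).toLinearMap this
  obtain ⟨bP⟩ := exists_hilbertBasis_nat P hP
  let U : H ≃ₗᵢ[ℝ] P := bH.repr.trans bP.repr.symm
  refine ⟨(K.comp P.subtypeL).comp U.toContinuousLinearEquiv.toContinuousLinearMap, ?_, ?_⟩
  · rw [injective_iff_map_eq_zero]
    intro h hh
    have h1 : (U h : lp (fun _ : ℕ => ℝ) 2) ∈ N := hh
    have h2 := (U h).2
    have h3 : (U h : lp (fun _ : ℕ => ℝ) 2) = 0 := by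
      have := N.inf_orthogonal_eq_bot
      exact (Submodule.mem_bot ℝ).1 (this ▸ ⟨h1, h2⟩)
    simpa using h3
  · exact hKP.comp U.surjective.denseRange (K.comp P.subtypeL).continuous

theorem exists_quasi_complement_of_separable_quotient {X H E : Type*} [NormedAddCommGroup X]
    [NormedSpace ℝ X] [CompleteSpace X] [NormedAddCommGroup H] [InnerProductSpace ℝ H]
    [CompleteSpace H] [TopologicalSpace.SeparableSpace H]
    [NormedAddCommGroup E] [NormedSpace ℝ E] [CompleteSpace E]
    [TopologicalSpace.SeparableSpace E] (hE : ¬ FiniteDimensional ℝ E)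
    (J : X →L[ℝ] H) (hJ : Function.Injective J) (Y : Submodule ℝ X)
    (hY : ¬ FiniteDimensional ℝ Y) (q : X →L[ℝ] E) (hq : Function.Surjective q)
    (hqY : ∀ y ∈ Y, q y = 0) :
    ∃ Z : Submodule ℝ X, IsClosed (Z : Set X) ∧ Y ⊓ Z = ⊥ ∧
      Dense ((Y ⊔ Z : Submodule ℝ X) : Set X) := by
  let G := (Y.map J.toLinearMap).topologicalClosure
  have hGc : CompleteSpace G := (Submodule.isClosed_topologicalClosure _).completeSpace_coe
  have hJG : ∀ y ∈ Y, J y ∈ G := fun y hy =>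
    Submodule.le_topologicalClosure _ ⟨y, hy, rfl⟩
  have hG : ¬ FiniteDimensional ℝ G := fun hfin => hY <| by
    let f : Y →ₗ[ℝ] G := (J.toLinearMap.comp Y.subtype).codRestrict G fun y => hJG y y.2
    refine FiniteDimensional.of_injective f fun a b hab => ?_
    exact Subtype.ext (hJ (congrArg Subtype.val hab))
  obtain ⟨K, hKi, hKd⟩ := exists_injective_denseRange G E hG hE
  let S : X →L[ℝ] E := (K.comp G.orthogonalProjectionOnto).comp J
  have hS : ∀ y (hy : y ∈ Y), S y = K ⟨J y, hJG y hy⟩ := fun y hy => by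
    have : G.orthogonalProjectionOnto (J y) = ⟨J y, hJG y hy⟩ :=
      Submodule.orthogonalProjectionOnto_mem_subspace_eq_self (⟨J y, hJG y hy⟩ : G)
    simp [S, this]
  have hSi : ∀ y ∈ Y, S y = 0 → y = 0 := fun y hy h0 => by
    rw [hS y hy, map_eq_zero_iff K hKi] at h0
    exact (map_eq_zero_iff J hJ).1 (congrArg Subtype.val h0)
  have hSd : DenseRange fun y : Y => S y := by
    have h1 : DenseRange fun y : Y => (⟨J y, hJG y y.2⟩ : G) := by
      intro g
      rw [closure_subtype]
      have h2 := g.2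
      refine closure_mono ?_ (show (g : H) ∈ closure (Y.map J.toLinearMap : Set H) from h2)
      rintro _ ⟨y, hy, rfl⟩
      exact ⟨⟨J y, hJG y hy⟩, ⟨⟨y, hy⟩, rfl⟩, rfl⟩
    have h3 : (fun y : Y => S y) = K ∘ fun y : Y => (⟨J y, hJG y y.2⟩ : G) :=
      funext fun y => hS y y.2
    rw [h3]
    exact hKd.comp h1 K.continuous
  obtain ⟨C, hC0, hC⟩ := q.exists_preimage_norm_le hq
  let c : ℝ := (2 * C * (‖S‖ + 1))⁻¹
  have hc : 0 < c := by positivity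
  let T : X →L[ℝ] E := q + c • S
  have hT : Function.Surjective T := by
    refine T.surjective_of_approx C fun y => ?_
    obtain ⟨x, hx, hxn⟩ := hC y
    refine ⟨x, hxn, ?_⟩
    have : y - T x = -(c • S x) := by simp [T, hx]
    rw [this, norm_neg, norm_smul, Real.norm_of_nonneg hc.le]
    calc c * ‖S x‖ ≤ c * ((‖S‖ + 1) * (C * ‖y‖)) := by
          gcongr
          exact (S.le_opNorm x).trans (by gcongr; linarith)
      _ = ‖y‖ / 2 := by simp only [c]; field_simp
  have hTY : ∀ y ∈ Y, T y = c • S y := fun y hy => by simp [T, hqY y hy]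
  refine ⟨T.ker, T.isClosed_ker, ?_, ?_⟩
  · rw [eq_bot_iff]
    rintro y ⟨hy, hyT⟩
    have h0 : T y = 0 := hyT
    rw [hTY y hy, smul_eq_zero_iff_right hc.ne'] at h0
    exact hSi y hy h0
  · obtain ⟨D, hD0, hD⟩ := T.exists_preimage_norm_le hT
    rw [Metric.dense_iff]
    intro x r hr
    obtain ⟨y, hy⟩ := hSd.exists_dist_lt (c⁻¹ • T x) (ε := r / (c * D)) (by positivity)
    obtain ⟨z, hz, hzn⟩ := hD (T (x - y))
    refine ⟨x - z, ?_, ?_⟩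
    · rw [Metric.mem_ball, dist_eq_norm, sub_sub_cancel_left, norm_neg]
      have h1 : T (x - y) = c • (c⁻¹ • T x - S y) := by
        rw [map_sub, hTY y y.2, smul_sub, smul_inv_smul₀ hc.ne']
      rw [h1, norm_smul, Real.norm_of_nonneg hc.le, ← dist_eq_norm] at hzn
      calc ‖z‖ ≤ D * (c * dist (c⁻¹ • T x) (S y)) := hzn
        _ < D * (c * (r / (c * D))) := by gcongr
        _ = r := by field_simp
    · refine Submodule.mem_sup.2 ⟨y, y.2, x - z - y, ?_, by abel⟩
      show T _ = 0
      rw [map_sub] at hz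
      simp only [map_sub, hz]
      abel

theorem Finset.sum_powerset_prod_ite {R : Type*} [CommRing R] (s : Finset ℕ) (u v : ℕ → R) :
    ∑ t ∈ s.powerset, ∏ k ∈ s, (if k ∈ t then u k else v k) = ∏ k ∈ s, (u k + v k) := by
  rw [Finset.prod_add]
  refine Finset.sum_congr rfl fun t ht => ?_
  rw [← Finset.inter_eq_right.2 (Finset.mem_powerset.1 ht), Finset.sdiff_inter_self_left,
    ← Finset.prod_piecewise, Finset.inter_eq_right.2 (Finset.mem_powerset.1 ht)]
  rfl

/-- The `i`-th Rademacher function on the finite subsets of `ℕ`. -/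
def rademacher (i : ℕ) (t : Finset ℕ) : ℝ := if i ∈ t then -1 else 1

theorem abs_rademacher (i : ℕ) (t : Finset ℕ) : |rademacher i t| = 1 := by
  unfold rademacher; split_ifs <;> simp

theorem rademacher_sq (i : ℕ) (t : Finset ℕ) : rademacher i t * rademacher i t = 1 := by
  unfold rademacher; split_ifs <;> simp

theorem rademacher_eq_prod {n i : ℕ} (hi : i < n) (t : Finset ℕ) :
    rademacher i t = ∏ k ∈ Finset.range n, if k ∈ t then (if k = i then -1 else 1) else 1 := by
  rw [Finset.prod_eq_single i]
  · simp [rademacher]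
  · intro k _ hk
    simp [hk]
  · intro h
    exact absurd (Finset.mem_range.2 hi) h

theorem sum_rademacher_mul {n i j : ℕ} (hi : i < n) (hj : j < n) :
    ∑ t ∈ (Finset.range n).powerset, rademacher i t * rademacher j t =
      if i = j then 2 ^ n else 0 := by
  split_ifs with h
  · subst h
    simp [rademacher_sq]
  · have h1 : ∀ t, rademacher i t * rademacher j t = ∏ k ∈ Finset.range n,
        if k ∈ t then ((if k = i then -1 else 1) * (if k = j then -1 else 1) : ℝ) else 1 := by
      intro t
      rw [rademacher_eq_prod hi, rademacher_eq_prod hj, ← Finset.prod_mul_distrib]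
      refine Finset.prod_congr rfl fun k _ => ?_
      split_ifs <;> simp
    simp_rw [h1]
    rw [Finset.sum_powerset_prod_ite]
    exact Finset.prod_eq_zero (Finset.mem_range.2 hi) (by simp [h])

/-- The average of `b` against the `i`-th Rademacher function over the subsets of `range n`. -/
noncomputable def rademacherCoeff (n : ℕ) (b : Finset ℕ → ℝ) (i : ℕ) : ℝ :=
  (2 ^ n)⁻¹ * ∑ t ∈ (Finset.range n).powerset, b t * rademacher i t

theorem sum_mul_rademacher (n : ℕ) (b : Finset ℕ → ℝ) (i : ℕ) :
    ∑ t ∈ (Finset.range n).powerset, b t * rademacher i t = 2 ^ n * rademacherCoeff n b i := by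
  simp [rademacherCoeff]

theorem abs_rademacherCoeff_le (n : ℕ) (b : Finset ℕ → ℝ) (i : ℕ) {B : ℝ} (hb : ∀ t, |b t| ≤ B) :
    |rademacherCoeff n b i| ≤ B := by
  rw [rademacherCoeff, abs_mul, abs_of_pos (by positivity), inv_mul_le_iff₀ (by positivity)]
  calc _ ≤ ∑ t ∈ (Finset.range n).powerset, |b t * rademacher i t| :=
        Finset.abs_sum_le_sum_abs _ _
    _ ≤ ∑ t ∈ (Finset.range n).powerset, B :=
        Finset.sum_le_sum fun t _ => by rw [abs_mul, abs_rademacher, mul_one]; exact hb t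
    _ = 2 ^ n * B := by simp

theorem sum_rademacherCoeff_sq_le {n : ℕ} (b : Finset ℕ → ℝ) {B : ℝ} (hb : ∀ t, |b t| ≤ B)
    (s : Finset ℕ) (hs : ∀ i ∈ s, i < n) : ∑ i ∈ s, rademacherCoeff n b i ^ 2 ≤ B ^ 2 := by
  set c := rademacherCoeff n b with hc
  have h0 : 0 ≤ ∑ t ∈ (Finset.range n).powerset, (b t - ∑ i ∈ s, c i * rademacher i t) ^ 2 :=
    Finset.sum_nonneg fun _ _ => sq_nonneg _
  have h1 : ∑ t ∈ (Finset.range n).powerset, b t * ∑ i ∈ s, c i * rademacher i t =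
      2 ^ n * ∑ i ∈ s, c i ^ 2 := by
    simp_rw [Finset.mul_sum]
    rw [Finset.sum_comm]
    refine Finset.sum_congr rfl fun i _ => ?_
    simp_rw [mul_left_comm (b _) (c i), ← Finset.mul_sum, sum_mul_rademacher, ← hc]
    ring
  have h2 : ∑ t ∈ (Finset.range n).powerset, (∑ i ∈ s, c i * rademacher i t) ^ 2 =
      2 ^ n * ∑ i ∈ s, c i ^ 2 := by
    simp_rw [sq, Finset.sum_mul_sum]
    rw [Finset.sum_comm, Finset.mul_sum]
    refine Finset.sum_congr rfl fun i hi => ?_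
    rw [Finset.sum_comm]
    have h : ∀ j t, c i * rademacher i t * (c j * rademacher j t) =
        c i * c j * (rademacher i t * rademacher j t) := fun j t => by ring
    simp_rw [h, ← Finset.mul_sum]
    rw [Finset.sum_congr rfl fun j hj => by rw [sum_rademacher_mul (hs i hi) (hs j hj)]]
    simp [hi]
    ring
  have h3 : ∑ t ∈ (Finset.range n).powerset, b t ^ 2 ≤ 2 ^ n * B ^ 2 := by
    calc _ ≤ ∑ t ∈ (Finset.range n).powerset, B ^ 2 :=
          Finset.sum_le_sum fun t _ => sq_le_sq' (abs_le.1 (hb t)).1 (abs_le.1 (hb t)).2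
      _ = 2 ^ n * B ^ 2 := by simp
  have h4 : ∑ t ∈ (Finset.range n).powerset, (b t - ∑ i ∈ s, c i * rademacher i t) ^ 2 =
      (∑ t ∈ (Finset.range n).powerset, b t ^ 2) - 2 ^ n * ∑ i ∈ s, c i ^ 2 := by
    simp_rw [sub_sq, Finset.sum_add_distrib, Finset.sum_sub_distrib, mul_assoc,
      ← Finset.mul_sum, h1, h2]
    ring
  have h5 : 2 ^ n * ∑ i ∈ s, c i ^ 2 ≤ 2 ^ n * B ^ 2 := by linarith
  exact le_of_mul_le_mul_left h5 (by positivity)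

/-- The imaginary part of a Riesz product. -/
noncomputable def rieszProduct (a : ℕ → ℝ) (n : ℕ) (t : Finset ℕ) : ℝ :=
  (∏ k ∈ Finset.range n, (1 + Complex.I * (a k * rademacher k t : ℝ))).im

theorem rademacherCoeff_rieszProduct (a : ℕ → ℝ) {n i : ℕ} (hi : i < n) :
    rademacherCoeff n (rieszProduct a n) i = a i := by
  have h1 : ∀ t, ((rademacher i t : ℝ) : ℂ) *
      ∏ k ∈ Finset.range n, (1 + Complex.I * (a k * rademacher k t : ℝ)) =
      ∏ k ∈ Finset.range n, if k ∈ t then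
        (if k = i then -1 else 1) * (1 - Complex.I * a k) else 1 + Complex.I * a k := by
    intro t
    rw [rademacher_eq_prod hi, Complex.ofReal_prod, ← Finset.prod_mul_distrib]
    refine Finset.prod_congr rfl fun k _ => ?_
    by_cases hk : k ∈ t <;> by_cases hki : k = i <;> simp [hk, hki, rademacher] <;>
      simp_all [sub_eq_add_neg]
  have h2 : ∑ t ∈ (Finset.range n).powerset, ((rademacher i t : ℝ) : ℂ) *
      ∏ k ∈ Finset.range n, (1 + Complex.I * (a k * rademacher k t : ℝ)) =
      2 ^ n * (Complex.I * a i) := by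
    simp_rw [h1]
    rw [Finset.sum_powerset_prod_ite]
    have h3 : ∀ k ∈ Finset.range n, ((if k = i then -1 else 1) * (1 - Complex.I * a k) +
        (1 + Complex.I * a k) : ℂ) = 2 * (if k = i then Complex.I * a i else 1) := by
      intro k _
      split_ifs with h
      · subst h; ring
      · ring
    rw [Finset.prod_congr rfl h3, Finset.prod_mul_distrib]
    simp [hi]
  have h3 := congrArg Complex.im h2
  rw [Complex.im_sum] at h3
  simp_rw [Complex.im_ofReal_mul] at h3
  rw [rademacherCoeff, inv_mul_eq_iff_eq_mul₀ (by positivity)]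
  calc _ = ∑ t ∈ (Finset.range n).powerset, rademacher i t *
        (∏ k ∈ Finset.range n, (1 + Complex.I * (a k * rademacher k t : ℝ))).im :=
        Finset.sum_congr rfl fun t _ => mul_comm _ _
    _ = _ := by
      rw [h3]
      have : (2 ^ n * (Complex.I * a i) : ℂ) = ((2 ^ n * a i : ℝ) : ℂ) * Complex.I := by
        push_cast; ring
      rw [this, Complex.im_ofReal_mul, Complex.I_im, mul_one]

theorem abs_rieszProduct_le (a : ℕ → ℝ) (ha : Summable fun k => a k ^ 2) (n : ℕ) (t : Finset ℕ) :
    |rieszProduct a n t| ≤ Real.exp (∑' k, a k ^ 2) := by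
  refine (Complex.abs_im_le_norm _).trans ?_
  rw [norm_prod]
  calc _ ≤ ∏ k ∈ Finset.range n, Real.exp (a k ^ 2) := by
        refine Finset.prod_le_prod (fun _ _ => norm_nonneg _) fun k _ => ?_
        have h1 : ‖1 + Complex.I * (a k * rademacher k t : ℝ)‖ ^ 2 = 1 + a k ^ 2 := by
          rw [Complex.sq_norm, Complex.normSq_apply]
          simp only [Complex.add_re, Complex.one_re, Complex.mul_re, Complex.I_re, Complex.I_im,
            Complex.ofReal_re, Complex.ofReal_im, Complex.add_im, Complex.one_im, Complex.mul_im]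
          linear_combination a k ^ 2 * rademacher_sq k t
        have h2 := Real.add_one_le_exp (a k ^ 2)
        nlinarith [norm_nonneg (1 + Complex.I * (a k * rademacher k t : ℝ)), sq_nonneg (a k)]
    _ = Real.exp (∑ k ∈ Finset.range n, a k ^ 2) := (Real.exp_sum _ _).symm
    _ ≤ _ := Real.exp_le_exp.2 (ha.sum_le_tsum _ fun _ _ => sq_nonneg _)

open Filter Topology BoundedContinuousFunction in
/-- `ℓ²` is a quotient of `ℓ^∞`. -/
theorem exists_surjective_l2 :
    ∃ T : BoundedContinuousFunction ℕ ℝ →L[ℝ] lp (fun _ : ℕ => ℝ) 2, Function.Surjective T := by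
  let e : ℕ × Finset ℕ ≃ ℕ := Denumerable.eqv _
  let c : BoundedContinuousFunction ℕ ℝ → ℕ → ℕ → ℝ := fun x n i =>
    rademacherCoeff n (fun t => x (e (n, t))) i
  have hb : ∀ (x : BoundedContinuousFunction ℕ ℝ) n t, |x (e (n, t))| ≤ ‖x‖ := fun x n t =>
    x.norm_coe_le_norm _
  let U : Ultrafilter ℕ := hyperfilter ℕ
  have hU : ∀ N, ∀ᶠ n in (U : Filter ℕ), N ≤ n := fun N =>
    (Nat.hyperfilter_le_atTop) (eventually_ge_atTop N)
  have hlim : ∀ x i, ∃ l, Tendsto (fun n => c x n i) U (𝓝 l) := by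
    intro x i
    obtain ⟨l, -, hl⟩ := (isCompact_Icc (a := -‖x‖) (b := ‖x‖)).ultrafilter_le_nhds
      (U.map fun n => c x n i) (by
        rw [le_principal_iff]
        refine Ultrafilter.mem_map.2 (Filter.Eventually.of_forall fun n => ?_)
        exact Set.mem_Icc.2 (abs_le.1 (abs_rademacherCoeff_le n _ i (hb x n))))
    exact ⟨l, hl⟩
  choose l hl using hlim
  have hsum : ∀ x (s : Finset ℕ), ∑ i ∈ s, l x i ^ 2 ≤ ‖x‖ ^ 2 := by
    intro x s
    refine le_of_tendsto (tendsto_finsetSum s fun i _ => (hl x i).pow 2) ?_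
    filter_upwards [hU (s.sup id + 1)] with n hn
    exact sum_rademacherCoeff_sq_le _ (hb x n) s fun i hi =>
      lt_of_lt_of_le (Nat.lt_succ_of_le (Finset.le_sup (f := id) hi)) hn
  have hsum' : ∀ x (s : Finset ℕ), ∑ i ∈ s, ‖l x i‖ ^ (2 : ℝ≥0∞).toReal ≤ ‖x‖ ^ 2 := by
    intro x s
    simpa using hsum x s
  have hadd : ∀ x y i, l (x + y) i = l x i + l y i := fun x y i => by
    refine tendsto_nhds_unique (hl (x + y) i) (((hl x i).add (hl y i)).congr fun n => ?_)
    simp only [c, rademacherCoeff, BoundedContinuousFunction.add_apply, add_mul,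
      Finset.sum_add_distrib, mul_add]
  have hsmul : ∀ (r : ℝ) x i, l (r • x) i = r * l x i := fun r x i => by
    refine tendsto_nhds_unique (hl (r • x) i) (((hl x i).const_mul r).congr fun n => ?_)
    simp only [c, rademacherCoeff, BoundedContinuousFunction.coe_smul, smul_eq_mul, mul_assoc,
      ← Finset.mul_sum]
    ring
  let T₀ : BoundedContinuousFunction ℕ ℝ →ₗ[ℝ] lp (fun _ : ℕ => ℝ) 2 :=
    { toFun := fun x => ⟨l x, memℓp_gen' (hsum' x)⟩
      map_add' := fun x y => by ext i; exact hadd x y i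
      map_smul' := fun r x => by ext i; exact hsmul r x i }
  refine ⟨T₀.mkContinuous 1 fun x => ?_, fun a => ?_⟩
  · rw [one_mul]
    refine lp.norm_le_of_forall_sum_le (by norm_num) (norm_nonneg _) fun s => ?_
    simpa [T₀] using hsum x s
  · have ha : Summable fun k => a k ^ 2 := by
      simpa using (lp.memℓp a).summable (by norm_num)
    let x : BoundedContinuousFunction ℕ ℝ := BoundedContinuousFunction.ofNormedAddCommGroupDiscrete
      (fun m => rieszProduct a (e.symm m).1 (e.symm m).2) _
      (fun m => abs_rieszProduct_le a ha _ _)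
    refine ⟨x, ?_⟩
    ext i
    show l x i = a i
    refine tendsto_nhds_unique (hl x i) (tendsto_const_nhds.congr' ?_)
    filter_upwards [hU (i + 1)] with n hn
    simp only [c, x, BoundedContinuousFunction.coe_ofNormedAddCommGroupDiscrete,
      Equiv.symm_apply_apply]
    exact (rademacherCoeff_rieszProduct a hn).symm

section SolidNorm

open BoundedContinuousFunction Set

variable {F : Type*} [NormedAddCommGroup F] [NormedSpace ℝ F]

/-- The supremum of `‖Q u‖` over the order interval `|u| ≤ z`. -/
noncomputable def solidNorm (Q : (ℕ →ᵇ ℝ) →L[ℝ] F) (z : ℕ → ℝ) : ℝ :=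
  sSup {r | ∃ u : ℕ →ᵇ ℝ, (∀ n, |u n| ≤ z n) ∧ ‖Q u‖ = r}

theorem solidNorm_le (Q : (ℕ →ᵇ ℝ) →L[ℝ] F) {z : ℕ → ℝ} {C : ℝ} (hC : 0 ≤ C)
    (h : ∀ u : ℕ →ᵇ ℝ, (∀ n, |u n| ≤ z n) → ‖Q u‖ ≤ C) : solidNorm Q z ≤ C := by
  refine Real.sSup_le ?_ hC
  rintro _ ⟨u, hu, rfl⟩
  exact h u hu

theorem solidNorm_nonneg (Q : (ℕ →ᵇ ℝ) →L[ℝ] F) (z : ℕ → ℝ) : 0 ≤ solidNorm Q z := by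
  refine Real.sSup_nonneg ?_
  rintro _ ⟨u, -, rfl⟩
  exact norm_nonneg _

theorem norm_apply_le_of_abs_le (Q : (ℕ →ᵇ ℝ) →L[ℝ] F) {C : ℝ} {u : ℕ →ᵇ ℝ}
    (hu : ∀ n, |u n| ≤ C) : ‖Q u‖ ≤ ‖Q‖ * C :=
  Q.le_opNorm_of_le ((BoundedContinuousFunction.norm_le ((abs_nonneg _).trans (hu 0))).2 hu)

theorem norm_apply_le_solidNorm (Q : (ℕ →ᵇ ℝ) →L[ℝ] F) {z : ℕ → ℝ} (hz : BddAbove (range z))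
    {u : ℕ →ᵇ ℝ} (hu : ∀ n, |u n| ≤ z n) : ‖Q u‖ ≤ solidNorm Q z := by
  obtain ⟨C, hC⟩ := hz
  refine le_csSup ⟨‖Q‖ * C, ?_⟩ ⟨u, hu, rfl⟩
  rintro _ ⟨v, hv, rfl⟩
  exact norm_apply_le_of_abs_le Q fun n => (hv n).trans (hC ⟨n, rfl⟩)

theorem solidNorm_le_of_le (Q : (ℕ →ᵇ ℝ) →L[ℝ] F) {z : ℕ → ℝ} {C : ℝ} (hC : 0 ≤ C)
    (hz : ∀ n, z n ≤ C) : solidNorm Q z ≤ ‖Q‖ * C :=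
  solidNorm_le Q (by positivity) fun _ hu =>
    norm_apply_le_of_abs_le Q fun n => (hu n).trans (hz n)

theorem solidNorm_mono (Q : (ℕ →ᵇ ℝ) →L[ℝ] F) {z w : ℕ → ℝ} (hw : BddAbove (range w))
    (h : ∀ n, z n ≤ w n) : solidNorm Q z ≤ solidNorm Q w :=
  solidNorm_le Q (solidNorm_nonneg Q w) fun _ hu =>
    norm_apply_le_solidNorm Q hw fun n => (hu n).trans (h n)

theorem solidNorm_add_le (Q : (ℕ →ᵇ ℝ) →L[ℝ] F) {z w : ℕ → ℝ} (hz : BddAbove (range z))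
    (hw : BddAbove (range w)) (hz0 : ∀ n, 0 ≤ z n) (hw0 : ∀ n, 0 ≤ w n) :
    solidNorm Q (z + w) ≤ solidNorm Q z + solidNorm Q w := by
  refine solidNorm_le Q (add_nonneg (solidNorm_nonneg Q z) (solidNorm_nonneg Q w)) fun u hu => ?_
  obtain ⟨C, hC⟩ := hz
  have hb : ∀ n, |max (-z n) (min (u n) (z n))| ≤ z n := fun n =>
    abs_le.2 ⟨le_max_left _ _, max_le (by linarith [hz0 n]) (min_le_right _ _)⟩
  let v : ℕ →ᵇ ℝ := ofNormedAddCommGroupDiscrete (fun n => max (-z n) (min (u n) (z n))) C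
    fun n => (hb n).trans (hC ⟨n, rfl⟩)
  have hv : ∀ n, v n = max (-z n) (min (u n) (z n)) := fun n => rfl
  have h1 : ‖Q v‖ ≤ solidNorm Q z := norm_apply_le_solidNorm Q ⟨C, hC⟩ hb
  have h2 : ‖Q (u - v)‖ ≤ solidNorm Q w := norm_apply_le_solidNorm Q hw fun n => by
    have h3 := abs_le.1 (hu n)
    have := hz0 n
    have := hw0 n
    simp only [Pi.add_apply] at h3
    rw [BoundedContinuousFunction.sub_apply, hv, abs_le]
    rcases le_total (u n) (z n) with h | h <;> rcases le_total (-z n) (u n) with h' | h' <;>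
      simp [h, h', this, hz0 n] <;> constructor <;> linarith
  calc ‖Q u‖ = ‖Q v + Q (u - v)‖ := by rw [← map_add, add_sub_cancel]
    _ ≤ _ := (norm_add_le _ _).trans (add_le_add h1 h2)

theorem add_le_solidNorm (f : (ℕ →ᵇ ℝ) →L[ℝ] ℝ) {z w : ℕ → ℝ} (hz : BddAbove (range z))
    (hw : BddAbove (range w)) (hz0 : ∀ n, 0 ≤ z n) (hw0 : ∀ n, 0 ≤ w n) :
    solidNorm f z + solidNorm f w ≤ solidNorm f (z + w) := by
  have hsign : ∀ u : ℕ →ᵇ ℝ, ∃ v : ℕ →ᵇ ℝ, (∀ n, |v n| = |u n|) ∧ f v = ‖f u‖ := fun u => by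
    rcases le_total 0 (f u) with h | h
    · exact ⟨u, fun _ => rfl, (Real.norm_of_nonneg h).symm⟩
    · exact ⟨-u, fun n => by simp, by rw [map_neg, Real.norm_of_nonpos h]⟩
  have hzw : BddAbove (range (z + w)) := by
    obtain ⟨C, hC⟩ := hz
    obtain ⟨D, hD⟩ := hw
    refine ⟨C + D, ?_⟩
    rintro _ ⟨n, rfl⟩
    exact add_le_add (hC ⟨n, rfl⟩) (hD ⟨n, rfl⟩)
  have key : ∀ u v : ℕ →ᵇ ℝ, (∀ n, |u n| ≤ z n) → (∀ n, |v n| ≤ w n) →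
      ‖f u‖ + ‖f v‖ ≤ solidNorm f (z + w) := fun u v hu hv => by
    obtain ⟨u', hu', hfu⟩ := hsign u
    obtain ⟨v', hv', hfv⟩ := hsign v
    rw [← hfu, ← hfv, ← map_add]
    refine (le_abs_self _).trans (norm_apply_le_solidNorm f hzw fun n => ?_)
    refine (abs_add_le _ _).trans (add_le_add ?_ ?_)
    · rw [hu']; exact hu n
    · rw [hv']; exact hv n
  have h1 : ∀ v : ℕ →ᵇ ℝ, (∀ n, |v n| ≤ w n) →
      solidNorm f z ≤ solidNorm f (z + w) - ‖f v‖ := fun v hv => by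
    refine solidNorm_le f ?_ fun u hu => by linarith [key u v hu hv]
    have := key 0 v (by simpa using hz0) hv
    simp only [map_zero, norm_zero] at this
    linarith
  have h2 : solidNorm f w ≤ solidNorm f (z + w) - solidNorm f z := by
    refine solidNorm_le f ?_ fun v hv => by linarith [h1 v hv]
    have := h1 0 (by simpa using hw0)
    simp only [map_zero, norm_zero] at this
    linarith
  linarith

theorem solidNorm_smul_le (Q : (ℕ →ᵇ ℝ) →L[ℝ] F) {z : ℕ → ℝ} (hz : BddAbove (range z)) {c : ℝ}
    (hc : 0 ≤ c) : solidNorm Q (c • z) ≤ c * solidNorm Q z := by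
  refine solidNorm_le Q (mul_nonneg hc (solidNorm_nonneg Q z)) fun u hu => ?_
  rcases hc.eq_or_lt with rfl | hc
  · have : u = 0 := by
      ext n
      simpa using hu n
    simp [this]
  · have h1 : ‖Q (c⁻¹ • u)‖ ≤ solidNorm Q z := norm_apply_le_solidNorm Q hz fun n => by
      have := hu n
      simp only [Pi.smul_apply, smul_eq_mul] at this
      simp only [BoundedContinuousFunction.coe_smul, smul_eq_mul, abs_mul,
        abs_of_pos (inv_pos.2 hc)]
      rwa [inv_mul_le_iff₀ hc]
    rw [map_smul, norm_smul, Real.norm_of_nonneg (inv_pos.2 hc).le, inv_mul_le_iff₀ hc] at h1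
    exact h1

/-- The supremum of `‖Q u‖` over all `u` in the unit ball vanishing outside `A`. -/
noncomputable def solidMeas (Q : (ℕ →ᵇ ℝ) →L[ℝ] F) (A : Set ℕ) : ℝ :=
  solidNorm Q (A.indicator 1)

theorem indicator_one_nonneg (A : Set ℕ) (n : ℕ) : (0 : ℝ) ≤ A.indicator 1 n :=
  indicator_nonneg (fun _ _ => zero_le_one) n

theorem indicator_one_le (A : Set ℕ) (n : ℕ) : A.indicator (1 : ℕ → ℝ) n ≤ 1 :=
  indicator_le_self' (f := (1 : ℕ → ℝ)) (fun _ _ => zero_le_one) n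

theorem bddAbove_indicator_one (A : Set ℕ) : BddAbove (range (A.indicator (1 : ℕ → ℝ))) := by
  refine ⟨1, ?_⟩
  rintro _ ⟨n, rfl⟩
  exact indicator_one_le A n

theorem solidMeas_nonneg (Q : (ℕ →ᵇ ℝ) →L[ℝ] F) (A : Set ℕ) : 0 ≤ solidMeas Q A :=
  solidNorm_nonneg Q _

theorem solidMeas_le (Q : (ℕ →ᵇ ℝ) →L[ℝ] F) (A : Set ℕ) : solidMeas Q A ≤ ‖Q‖ :=
  (solidNorm_le_of_le Q zero_le_one (indicator_one_le A)).trans_eq (mul_one _)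

theorem solidMeas_mono (Q : (ℕ →ᵇ ℝ) →L[ℝ] F) {A B : Set ℕ} (h : A ⊆ B) :
    solidMeas Q A ≤ solidMeas Q B :=
  solidNorm_mono Q (bddAbove_indicator_one B) fun n =>
    indicator_le_indicator_of_subset h (fun _ => zero_le_one) n

theorem solidMeas_empty (Q : (ℕ →ᵇ ℝ) →L[ℝ] F) : solidMeas Q ∅ = 0 :=
  le_antisymm ((solidNorm_le_of_le Q le_rfl (by simp)).trans_eq (mul_zero _))
    (solidMeas_nonneg Q _)

theorem solidMeas_union_le (Q : (ℕ →ᵇ ℝ) →L[ℝ] F) (A B : Set ℕ) :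
    solidMeas Q (A ∪ B) ≤ solidMeas Q A + solidMeas Q B := by
  refine le_trans (solidNorm_mono Q ?_ fun n => ?_) (solidNorm_add_le Q (bddAbove_indicator_one A)
    (bddAbove_indicator_one B) (indicator_one_nonneg A) (indicator_one_nonneg B))
  · refine ⟨1 + 1, ?_⟩
    rintro _ ⟨n, rfl⟩
    exact add_le_add (indicator_one_le A n) (indicator_one_le B n)
  · by_cases hA : n ∈ A <;> by_cases hB : n ∈ B <;> simp [hA, hB]

theorem solidMeas_biUnion_le (Q : (ℕ →ᵇ ℝ) →L[ℝ] F) (s : Finset ℕ) (A : ℕ → Set ℕ) :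
    solidMeas Q (⋃ i ∈ s, A i) ≤ ∑ i ∈ s, solidMeas Q (A i) := by
  induction s using Finset.induction_on with
  | empty => simp [solidMeas_empty]
  | insert i s hi ih =>
    rw [Finset.set_biUnion_insert, Finset.sum_insert hi]
    exact (solidMeas_union_le Q _ _).trans (by gcongr)

theorem solidMeas_add_le (f : (ℕ →ᵇ ℝ) →L[ℝ] ℝ) {A B : Set ℕ} (h : Disjoint A B) :
    solidMeas f A + solidMeas f B ≤ solidMeas f (A ∪ B) := by
  refine (add_le_solidNorm f (bddAbove_indicator_one A) (bddAbove_indicator_one B)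
    (indicator_one_nonneg A) (indicator_one_nonneg B)).trans_eq ?_
  rw [solidMeas, indicator_union_of_disjoint h]
  rfl

theorem norm_apply_le_mul_solidMeas (Q : (ℕ →ᵇ ℝ) →L[ℝ] F) {A : Set ℕ} {C : ℝ} (hC : 0 ≤ C)
    {u : ℕ →ᵇ ℝ} (hu : ∀ n, |u n| ≤ C) (hA : ∀ n, n ∉ A → u n = 0) :
    ‖Q u‖ ≤ C * solidMeas Q A := by
  refine le_trans (norm_apply_le_solidNorm Q (z := C • A.indicator 1) ?_ fun n => ?_)
    (solidNorm_smul_le Q (bddAbove_indicator_one A) hC)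
  · refine ⟨C, ?_⟩
    rintro _ ⟨n, rfl⟩
    exact mul_le_of_le_one_right hC (indicator_one_le A n)
  · by_cases h : n ∈ A
    · simpa [h] using hu n
    · simp [h, hA n h]

/-- **Rosenthal's disjointification lemma**, with an explicit bound on the total masses. -/
theorem exists_injective_solidMeas_le {η : ℝ} (hη : 0 ≤ η) (N : ℕ)
    (f : ℕ → (ℕ →ᵇ ℝ) →L[ℝ] ℝ) (A : ℕ → Set ℕ) (hA : Pairwise fun i j => Disjoint (A i) (A j))
    (hf : ∀ k, solidMeas (f k) (⋃ j, A j) ≤ N * η) :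
    ∃ φ : ℕ → ℕ, Function.Injective φ ∧
      ∀ k, solidMeas (f (φ k)) (⋃ j ∈ {j | j ≠ k}, A (φ j)) ≤ η := by
  induction N generalizing f A with
  | zero =>
    refine ⟨id, Function.injective_id, fun k => ?_⟩
    refine (solidMeas_mono _ (iUnion₂_subset fun j _ => subset_iUnion A j)).trans ((hf k).trans ?_)
    simpa using hη
  | succ N ih =>
    by_cases h : ∃ p, ∀ k, solidMeas (f (Nat.pair p k))
        (⋃ j ∈ {j | j ≠ k}, A (Nat.pair p j)) ≤ η
    · obtain ⟨p, hp⟩ := h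
      exact ⟨Nat.pair p, fun a b hab => (Nat.pair_eq_pair.1 hab).2, hp⟩
    · push Not at h
      choose k hk using h
      obtain ⟨ψ, hψ, h2⟩ := ih (fun p => f (Nat.pair p (k p))) (fun p => A (Nat.pair p (k p)))
        (fun p q hpq => hA fun h => hpq (Nat.pair_eq_pair.1 h).1) (fun p => by
          have hd : Disjoint (⋃ q, A (Nat.pair q (k q)))
              (⋃ j ∈ {j | j ≠ k p}, A (Nat.pair p j)) := by
            simp only [disjoint_iUnion_left, disjoint_iUnion_right]
            intro j hj q
            refine hA fun h => hj ?_
            obtain ⟨rfl, rfl⟩ := Nat.pair_eq_pair.1 h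
            rfl
          have h3 := solidMeas_add_le (f (Nat.pair p (k p))) hd
          have hsub : (⋃ q, A (Nat.pair q (k q))) ∪ (⋃ j ∈ {j | j ≠ k p}, A (Nat.pair p j)) ⊆
              ⋃ j, A j := union_subset
            (iUnion_subset fun q => subset_iUnion A (Nat.pair q (k q)))
            (iUnion₂_subset fun j _ => subset_iUnion A (Nat.pair p j))
          have h4 := (solidMeas_mono (f (Nat.pair p (k p))) hsub).trans (hf (Nat.pair p (k p)))
          have h5 := hk p
          push_cast at h4
          linarith)
      exact ⟨fun p => Nat.pair (ψ p) (k (ψ p)), fun a b hab => hψ (Nat.pair_eq_pair.1 hab).1, h2⟩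

/-- An operator on `ℓ^∞` bounded below on a disjoint sequence has a range admitting `ℓ²` as
a quotient. -/
theorem exists_surjective_l2_of_disjoint (Q : (ℕ →ᵇ ℝ) →L[ℝ] F) {δ : ℝ} (hδ : 0 < δ)
    (u : ℕ → ℕ →ᵇ ℝ) (hu : ∀ k n, |u k n| ≤ 1) (hd : ∀ n i j, u i n ≠ 0 → u j n ≠ 0 → i = j)
    (hQ : ∀ k, δ ≤ ‖Q (u k)‖) :
    ∃ q : F →L[ℝ] lp (fun _ : ℕ => ℝ) 2, Function.Surjective q := by
  choose g hg1 hg using fun k => exists_dual_vector'' ℝ (Q (u k))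
  let A : ℕ → Set ℕ := fun k => {n | u k n ≠ 0}
  have hA : Pairwise fun i j => Disjoint (A i) (A j) := fun i j hij =>
    disjoint_left.2 fun n hi hj => hij (hd n i j hi hj)
  obtain ⟨N, hN⟩ := exists_nat_ge (‖Q‖ / (δ / 2))
  obtain ⟨φ, hφ, hφd⟩ := exists_injective_solidMeas_le (half_pos hδ).le N
    (fun k => (g k).comp Q) A hA (fun k => by
      refine (solidMeas_le _ _).trans ?_
      rw [div_le_iff₀ (half_pos hδ)] at hN
      refine le_trans ?_ hN
      calc _ ≤ ‖g k‖ * ‖Q‖ := (g k).opNorm_comp_le Q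
        _ ≤ 1 * ‖Q‖ := by gcongr; exact hg1 k
        _ = ‖Q‖ := one_mul _)
  have hgb : ∀ y k, ‖g (φ k) y‖ ≤ ‖y‖ := fun y k => by
    simpa using (g (φ k)).le_of_opNorm_le (hg1 _) y
  let Γ₀ : F →ₗ[ℝ] (ℕ →ᵇ ℝ) :=
    { toFun := fun y => ofNormedAddCommGroupDiscrete (fun k => g (φ k) y) ‖y‖ (hgb y)
      map_add' := fun x y => by ext k; simp
      map_smul' := fun r x => by ext k; simp }
  let Γ : F →L[ℝ] (ℕ →ᵇ ℝ) := Γ₀.mkContinuous 1 fun y => by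
    rw [one_mul]
    exact (BoundedContinuousFunction.norm_le (norm_nonneg _)).2 (hgb y)
  have hΓ : ∀ y k, Γ y k = g (φ k) y := fun _ _ => rfl
  have hsurj : Function.Surjective (Γ.comp Q) := by
    refine (Γ.comp Q).surjective_of_approx δ⁻¹ fun b => ?_
    let c : ℕ → ℝ := fun k => b k / ‖Q (u (φ k))‖
    have hc : ∀ k, |c k| ≤ δ⁻¹ * ‖b‖ := fun k => by
      have h0 := hδ.trans_le (hQ (φ k))
      rw [abs_div, abs_norm, div_eq_inv_mul]
      exact mul_le_mul (inv_anti₀ hδ (hQ _)) (b.norm_coe_le_norm k) (abs_nonneg _) (by positivity)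
    have hval : ∀ n k, u (φ k) n ≠ 0 → ∑' j, c j * u (φ j) n = c k * u (φ k) n := fun n k hk => by
      refine tsum_eq_single k fun j hj => ?_
      by_contra h
      exact hj (hφ (hd n _ _ (right_ne_zero_of_mul h) hk))
    have hval0 : ∀ n, (∀ k, u (φ k) n = 0) → ∑' j, c j * u (φ j) n = 0 := fun n hn => by
      simp [hn]
    have hbd : ∀ n, |∑' j, c j * u (φ j) n| ≤ δ⁻¹ * ‖b‖ := fun n => by
      by_cases h : ∃ k, u (φ k) n ≠ 0
      · obtain ⟨k, hk⟩ := h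
        rw [hval n k hk, abs_mul]
        calc _ ≤ |c k| * 1 := by gcongr; exact hu _ _
          _ ≤ _ := by rw [mul_one]; exact hc k
      · push Not at h
        rw [hval0 n h, abs_zero]
        positivity
    let x : ℕ →ᵇ ℝ := ofNormedAddCommGroupDiscrete (fun n => ∑' j, c j * u (φ j) n) _ hbd
    have hx : ∀ n, x n = ∑' j, c j * u (φ j) n := fun _ => rfl
    refine ⟨x, (BoundedContinuousFunction.norm_le (by positivity)).2 hbd, ?_⟩
    refine (BoundedContinuousFunction.norm_le (by positivity)).2 fun k => ?_
    have h1 : (b - (Γ.comp Q) x) k = -((g (φ k)).comp Q) (x - c k • u (φ k)) := by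
      have h0 := hδ.trans_le (hQ (φ k))
      have h2 : c k * ‖Q (u (φ k))‖ = b k := div_mul_cancel₀ _ h0.ne'
      have h3 : g (φ k) (Q (u (φ k))) = ‖Q (u (φ k))‖ := hg _
      simp [hΓ, h3, h2]
    rw [h1, norm_neg]
    have hxk : ∀ n, u (φ k) n ≠ 0 → (x - c k • u (φ k)) n = 0 := fun n hn => by
      simp [hx, hval n k hn]
    have hxk' : ∀ n, u (φ k) n = 0 → (x - c k • u (φ k)) n = x n := fun n hn => by
      simp [hn]
    refine (norm_apply_le_mul_solidMeas ((g (φ k)).comp Q) (A := ⋃ j ∈ {j | j ≠ k}, A (φ j))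
      (C := δ⁻¹ * ‖b‖) (by positivity) (fun n => ?_) (fun n hn => ?_)).trans ?_
    · by_cases h : u (φ k) n = 0
      · rw [hxk' n h]; exact hbd n
      · rw [hxk n h, abs_zero]; positivity
    · by_cases h : u (φ k) n = 0
      · rw [hxk' n h, hx]
        refine hval0 n fun j => ?_
        by_contra hj
        refine hn (mem_iUnion₂.2 ⟨j, ?_, hj⟩)
        rintro rfl
        exact hj h
      · exact hxk n h
    · calc _ ≤ δ⁻¹ * ‖b‖ * (δ / 2) := by gcongr; exact hφd k
        _ = ‖b‖ / 2 := by field_simp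
  obtain ⟨T, hT⟩ := exists_surjective_l2
  refine ⟨T.comp Γ, hT.comp ?_⟩
  exact Function.Surjective.of_comp (g := Q) hsurj

end SolidNorm

section Exhaustive

open BoundedContinuousFunction Set Filter Topology

variable {F : Type*} [NormedAddCommGroup F] [NormedSpace ℝ F]

/-- `Q` is exhaustive if it is not bounded below on any disjoint sequence of the unit ball. -/
def IsExhaustive (Q : (ℕ →ᵇ ℝ) →L[ℝ] F) : Prop :=
  ∀ δ > 0, ∀ u : ℕ → ℕ →ᵇ ℝ, (∀ k n, |u k n| ≤ 1) →
    (∀ n i j, u i n ≠ 0 → u j n ≠ 0 → i = j) → ∃ k, ‖Q (u k)‖ < δ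

theorem exists_lt_norm_of_lt_solidMeas (Q : (ℕ →ᵇ ℝ) →L[ℝ] F) {A : Set ℕ} {η : ℝ} (hη : 0 ≤ η)
    (h : η < solidMeas Q A) :
    ∃ u : ℕ →ᵇ ℝ, (∀ n, |u n| ≤ 1) ∧ (∀ n, n ∉ A → u n = 0) ∧ η < ‖Q u‖ := by
  by_contra! hc
  refine h.not_ge (solidNorm_le Q hη fun u hu => hc u (fun n => (hu n).trans
    (indicator_one_le A n)) fun n hn => ?_)
  simpa [hn] using hu n

theorem IsExhaustive.exists_solidMeas_diff_le {Q : (ℕ →ᵇ ℝ) →L[ℝ] F} (hQ : IsExhaustive Q)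
    {B : ℕ → Set ℕ} (hB : Monotone B) {η : ℝ} (hη : 0 < η) (N₀ : ℕ) :
    ∃ N ≥ N₀, ∀ N', solidMeas Q (B N' \ B N) ≤ η := by
  by_contra! hc
  choose! s hs using hc
  have hlt : ∀ N ≥ N₀, N < s N := fun N hN => by
    by_contra! h
    have h1 := hs N hN
    rw [sdiff_eq_empty.2 (hB h), solidMeas_empty] at h1
    exact hη.not_gt h1
  let N : ℕ → ℕ := fun j => s^[j] N₀
  have hNs : ∀ j, N (j + 1) = s (N j) := fun j => Function.iterate_succ_apply' _ _ _
  have hN0 : ∀ j, N₀ ≤ N j := fun j => by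
    induction j with
    | zero => exact le_rfl
    | succ j ih => rw [hNs]; exact ih.trans (hlt _ ih).le
  have hNm : Monotone N := monotone_nat_of_le_succ fun j => by
    rw [hNs]; exact (hlt _ (hN0 j)).le
  choose u hu1 hu0 hu using fun j =>
    exists_lt_norm_of_lt_solidMeas Q hη.le (hs (N j) (hN0 j))
  have hd : ∀ n i j, u i n ≠ 0 → u j n ≠ 0 → i ≤ j := fun n i j hi hj => by
    by_contra! h
    have h1 : n ∈ B (s (N i)) \ B (N i) := by
      by_contra h'; exact hi (hu0 i n h')
    have h2 : n ∈ B (s (N j)) \ B (N j) := by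
      by_contra h'; exact hj (hu0 j n h')
    rw [← hNs] at h2
    exact h1.2 (hB (hNm h) h2.1)
  obtain ⟨k, hk⟩ := hQ η hη u hu1 fun n i j hi hj =>
    le_antisymm (hd n i j hi hj) (hd n j i hj hi)
  exact (hu k).not_gt hk

theorem solidMeas_comp_le (Q : (ℕ →ᵇ ℝ) →L[ℝ] F) {g : F →L[ℝ] ℝ} (hg : ‖g‖ ≤ 1) (A : Set ℕ) :
    solidMeas (g.comp Q) A ≤ solidMeas Q A :=
  solidNorm_le _ (solidMeas_nonneg Q A) fun u hu => by
    calc ‖g (Q u)‖ ≤ 1 * ‖Q u‖ := g.le_of_opNorm_le hg _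
      _ = ‖Q u‖ := one_mul _
      _ ≤ _ := norm_apply_le_solidNorm Q (bddAbove_indicator_one A) hu

theorem sum_Ico_half_pow_le (m n : ℕ) :
    ∑ i ∈ Finset.Ico m n, (1 / 2 : ℝ) ^ i ≤ 2 * (1 / 2) ^ m := by
  have := geom_sum_Ico_le_of_lt_one (x := (1 / 2 : ℝ)) (m := m) (n := n) (by norm_num) (by norm_num)
  exact this.trans_eq (by ring)

/-- The set function of an exhaustive operator is `ε`-`δ` controlled by finitely many
finitely additive ones. -/
theorem IsExhaustive.exists_finset_control {Q : (ℕ →ᵇ ℝ) →L[ℝ] F} (hQ : IsExhaustive Q) {ε : ℝ}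
    (hε : 0 < ε) : ∃ (G : Finset ((ℕ →ᵇ ℝ) →L[ℝ] ℝ)) (δ : ℝ), 0 < δ ∧
      ∀ A : Set ℕ, (∀ g ∈ G, solidMeas g A < δ) → solidMeas Q A ≤ ε := by
  classical
  by_contra! hc
  obtain ⟨f, hf, hr⟩ := exists_seq_of_forall_finset_exists
    (fun x : Set ℕ × ((ℕ →ᵇ ℝ) →L[ℝ] ℝ) × ℝ => ε < solidMeas x.2.1 x.1 ∧
      (∀ B, solidMeas x.2.1 B ≤ solidMeas Q B) ∧ 0 < x.2.2 ∧ x.2.2 ≤ 1)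
    (fun x y => solidMeas x.2.1 y.1 ≤ y.2.2 ∧ y.2.2 ≤ x.2.2 / 2) (fun s hs => by
      have h1 : ∀ᶠ δ in 𝓝[>] (0 : ℝ), ∀ x ∈ s, δ ≤ x.2.2 / 2 := by
        refine (Filter.eventually_all_finset s).2 fun x hx => ?_
        have : 0 < x.2.2 / 2 := half_pos (hs x hx).2.2.1
        filter_upwards [Ioo_mem_nhdsGT this] with δ hδ using hδ.2.le
      obtain ⟨δ, hδ1, hδ0⟩ := (h1.and (Ioo_mem_nhdsGT one_pos)).exists
      obtain ⟨A, hA, hQA⟩ := hc (s.image fun x => x.2.1) δ hδ0.1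
      obtain ⟨u, hu1, hu0, hu⟩ := exists_lt_norm_of_lt_solidMeas Q hε.le hQA
      obtain ⟨g, hg1, hg⟩ := exists_dual_vector'' ℝ (Q u)
      refine ⟨(A, g.comp Q, δ), ⟨?_, solidMeas_comp_le Q hg1, hδ0.1, hδ0.2.le⟩, fun x hx =>
        ⟨(hA _ (Finset.mem_image_of_mem _ hx)).le, hδ1 x hx⟩⟩
      have h2 := norm_apply_le_mul_solidMeas (g.comp Q) zero_le_one hu1 hu0
      have h3 : ‖(g.comp Q) u‖ = ‖Q u‖ := by
        simp only [ContinuousLinearMap.comp_apply, hg]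
        simp
      rw [h3, one_mul] at h2
      exact hu.trans_le h2)
  let A : ℕ → Set ℕ := fun k => (f k).1
  let g : ℕ → (ℕ →ᵇ ℝ) →L[ℝ] ℝ := fun k => (f k).2.1
  have hδ : ∀ k, (f k).2.2 ≤ (1 / 2) ^ k := fun k => by
    induction k with
    | zero => simpa using (hf 0).2.2.2
    | succ k ih =>
      have := (hr k (k + 1) k.lt_succ_self).2
      rw [pow_succ]
      linarith
  let C : ℕ → ℕ → Set ℕ := fun k N => ⋃ i ∈ Finset.Ico k N, A i
  have hC : ∀ k, Monotone (C k) := fun k N M h =>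
    biUnion_subset_biUnion_left fun i hi => Finset.Ico_subset_Ico_right h hi
  choose n hn hCn using fun k => hQ.exists_solidMeas_diff_le (hC k)
    (η := ε / 8 * (1 / 2) ^ k) (by positivity) (k + 1)
  let E : ℕ → Set ℕ := fun k => ⋂ i ∈ Finset.range (k + 1), C i (n i)
  have hE : Monotone fun k => (E k)ᶜ := fun k m h =>
    compl_subset_compl.2 (biInter_mono (fun i hi => by
      simp only [Finset.coe_range, mem_Iio] at *; omega) fun _ _ => subset_rfl)
  have hgE : ∀ k, ε - ε / 4 ≤ solidMeas (g k) (E k) := fun k => by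
    have h1 : A k \ E k ⊆ ⋃ i ∈ Finset.range (k + 1), C i (k + 1) \ C i (n i) := by
      rintro x ⟨hx, hxE⟩
      simp only [E, mem_iInter, not_forall] at hxE
      obtain ⟨i, hi, hxi⟩ := hxE
      refine mem_iUnion₂.2 ⟨i, hi, mem_iUnion₂.2 ⟨k, ?_, hx⟩, hxi⟩
      simp only [Finset.mem_range, Finset.mem_Ico] at *
      omega
    have h2 : solidMeas (g k) (A k \ E k) ≤ ε / 4 := by
      calc _ ≤ solidMeas Q (A k \ E k) := (hf k).2.1 _
        _ ≤ ∑ i ∈ Finset.range (k + 1), solidMeas Q (C i (k + 1) \ C i (n i)) :=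
          (solidMeas_mono Q h1).trans (solidMeas_biUnion_le Q _ _)
        _ ≤ ∑ i ∈ Finset.range (k + 1), ε / 8 * (1 / 2) ^ i :=
          Finset.sum_le_sum fun i _ => hCn i _
        _ ≤ ε / 8 * (2 * (1 / 2) ^ 0) := by
          rw [← Finset.mul_sum, Finset.range_eq_Ico]
          gcongr
          exact sum_Ico_half_pow_le 0 _
        _ = ε / 4 := by ring
    have h3 : A k ⊆ E k ∪ (A k \ E k) := by
      rw [union_sdiff_self]
      exact subset_union_right
    have h4 : ε < solidMeas (g k) (A k) := (hf k).1
    linarith [(solidMeas_mono (g k) h3).trans (solidMeas_union_le (g k) _ _)]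
  have hgE' : ∀ j m, j < m → solidMeas (g j) (E m) ≤ 2 * (1 / 2) ^ m := fun j m hjm => by
    have h1 : E m ⊆ ⋃ i ∈ Finset.Ico m (n m), A i :=
      biInter_subset_of_mem (by simp)
    calc _ ≤ ∑ i ∈ Finset.Ico m (n m), solidMeas (g j) (A i) :=
          (solidMeas_mono _ h1).trans (solidMeas_biUnion_le _ _ _)
      _ ≤ ∑ i ∈ Finset.Ico m (n m), (1 / 2) ^ i := Finset.sum_le_sum fun i hi =>
          (hr j i (hjm.trans_le (Finset.mem_Ico.1 hi).1)).1.trans (hδ i)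
      _ ≤ _ := sum_Ico_half_pow_le _ _
  obtain ⟨N, -, hN⟩ := hQ.exists_solidMeas_diff_le hE (η := ε / 4) (by positivity) 0
  obtain ⟨m₀, hm₀⟩ := exists_pow_lt_of_lt_one (show 0 < ε / 8 by positivity)
    (show (1 / 2 : ℝ) < 1 by norm_num)
  have hm : (1 / 2 : ℝ) ^ (max m₀ (N + 1)) ≤ (1 / 2) ^ m₀ :=
    pow_le_pow_of_le_one (by norm_num) (by norm_num) (le_max_left _ _)
  have h1 := hgE' N (max m₀ (N + 1)) (by simp)
  have h2 := hN (max m₀ (N + 1))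
  rw [compl_sdiff_compl] at h2
  have h3 : E N ⊆ (E N \ E (max m₀ (N + 1))) ∪ E (max m₀ (N + 1)) := by
    rw [sdiff_union_self]
    exact subset_union_left
  have h4 := (solidMeas_mono (g N) h3).trans (solidMeas_union_le (g N) _ _)
  have h5 : solidMeas (g N) (E N \ E (max m₀ (N + 1))) ≤
    solidMeas Q (E N \ E (max m₀ (N + 1))) := (hf N).2.1 _
  linarith [hgE N]

/-- The functional `z ↦ ∑ g ∈ G, |g| z`, defined for nonnegative bounded `z`. -/
noncomputable def sumSolidNorm (G : Finset ((ℕ →ᵇ ℝ) →L[ℝ] ℝ)) (z : ℕ → ℝ) : ℝ :=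
  ∑ g ∈ G, solidNorm g z

/-- A monotone, additive and positively homogeneous functional on nonnegative bounded sequences. -/
structure IsControl (L : (ℕ → ℝ) → ℝ) : Prop where
  nonneg : ∀ z, 0 ≤ L z
  mono : ∀ z w, BddAbove (range w) → (∀ n, z n ≤ w n) → L z ≤ L w
  add : ∀ z w, BddAbove (range z) → BddAbove (range w) → (∀ n, 0 ≤ z n) → (∀ n, 0 ≤ w n) →
    L (z + w) = L z + L w
  smul_le : ∀ (c : ℝ) (z), BddAbove (range z) → 0 ≤ c → L (c • z) ≤ c * L z

theorem isControl_sumSolidNorm (G : Finset ((ℕ →ᵇ ℝ) →L[ℝ] ℝ)) : IsControl (sumSolidNorm G) where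
  nonneg z := Finset.sum_nonneg fun g _ => solidNorm_nonneg g z
  mono z w hw h := Finset.sum_le_sum fun g _ => solidNorm_mono g hw h
  add z w hz hw hz0 hw0 := by
    rw [sumSolidNorm, sumSolidNorm, sumSolidNorm, ← Finset.sum_add_distrib]
    exact Finset.sum_congr rfl fun g _ =>
      (solidNorm_add_le g hz hw hz0 hw0).antisymm (add_le_solidNorm g hz hw hz0 hw0)
  smul_le c z hz hc := by
    rw [sumSolidNorm, sumSolidNorm, Finset.mul_sum]
    exact Finset.sum_le_sum fun g _ => solidNorm_smul_le g hz hc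

theorem IsControl.exists_tsum (L : ℕ → (ℕ → ℝ) → ℝ) (hL : ∀ m, IsControl (L m)) :
    ∃ (c : ℕ → ℝ) (Λ : (ℕ → ℝ) → ℝ), IsControl Λ ∧ (∀ m, 0 < c m) ∧
      ∀ m z, BddAbove (range z) → c m * L m z ≤ Λ z := by
  let c : ℕ → ℝ := fun m => (1 / 2) ^ m / (1 + L m 1)
  have h1 : ∀ m, 0 < 1 + L m 1 := fun m => by linarith [(hL m).nonneg 1]
  have hc : ∀ m, 0 < c m := fun m => div_pos (by positivity) (h1 m)
  have hc0 : ∀ m z, 0 ≤ c m * L m z := fun m z => mul_nonneg (hc m).le ((hL m).nonneg z)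
  have hs : ∀ z, BddAbove (range z) → Summable fun m => c m * L m z := by
    rintro z ⟨B, hB⟩
    refine .of_nonneg_of_le (fun m => hc0 m z) (fun m => ?_)
      (summable_geometric_two.mul_left |B|)
    have hb : BddAbove (range (1 : ℕ → ℝ)) := ⟨1, by rintro _ ⟨n, rfl⟩; exact le_rfl⟩
    have hb' : BddAbove (range (|B| • (1 : ℕ → ℝ))) := ⟨|B|, by rintro _ ⟨n, rfl⟩; simp⟩
    have h2 : L m z ≤ |B| * L m 1 := by
      refine ((hL m).mono z (|B| • 1) hb' fun n => ?_).trans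
        ((hL m).smul_le |B| 1 hb (abs_nonneg B))
      simpa using (hB ⟨n, rfl⟩).trans (le_abs_self B)
    calc c m * L m z ≤ c m * (|B| * (1 + L m 1)) := by
          gcongr
          · exact (hc m).le
          · exact h2.trans (by gcongr; linarith)
      _ = |B| * (1 / 2) ^ m := by
          have := (h1 m).ne'
          simp only [c]
          field_simp
  refine ⟨c, fun z => ∑' m, c m * L m z, ⟨fun z => tsum_nonneg fun m => hc0 m z,
    fun z w hw h => ?_, fun z w hz hw hz0 hw0 => ?_, fun r z hz hr => ?_⟩, hc, fun m z hz =>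
    (hs z hz).le_tsum m fun j _ => hc0 j z⟩
  · have hz : BddAbove (range z) := by
      obtain ⟨B, hB⟩ := hw
      refine ⟨B, ?_⟩
      rintro _ ⟨n, rfl⟩
      exact (h n).trans (hB ⟨n, rfl⟩)
    exact (hs z hz).tsum_le_tsum (fun m => mul_le_mul_of_nonneg_left ((hL m).mono z w hw h)
      (hc m).le) (hs w hw)
  · rw [← (hs z hz).tsum_add (hs w hw)]
    refine tsum_congr fun m => ?_
    rw [(hL m).add z w hz hw hz0 hw0, mul_add]
  · have hrz : BddAbove (range (r • z)) := by
      obtain ⟨B, hB⟩ := hz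
      refine ⟨r * B, ?_⟩
      rintro _ ⟨n, rfl⟩
      exact mul_le_mul_of_nonneg_left (hB ⟨n, rfl⟩) hr
    rw [← tsum_mul_left]
    refine (hs _ hrz).tsum_le_tsum (fun m => ?_) ((hs z hz).mul_left r)
    calc _ ≤ c m * (r * L m z) :=
          mul_le_mul_of_nonneg_left ((hL m).smul_le r z hz hr) (hc m).le
      _ = _ := by ring

theorem IsExhaustive.exists_isControl {Q : (ℕ →ᵇ ℝ) →L[ℝ] F} (hQ : IsExhaustive Q) :
    ∃ Λ : (ℕ → ℝ) → ℝ, IsControl Λ ∧ ∀ ε > 0, ∃ δ > 0, ∀ A : Set ℕ,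
      Λ (A.indicator 1) < δ → solidMeas Q A ≤ ε := by
  choose G δ hδ hG using fun m : ℕ => hQ.exists_finset_control
    (show (0 : ℝ) < 1 / (m + 1) from Nat.one_div_pos_of_nat)
  obtain ⟨c, Λ, hΛ, hc, hcΛ⟩ := IsControl.exists_tsum _ fun m => isControl_sumSolidNorm (G m)
  refine ⟨Λ, hΛ, fun ε hε => ?_⟩
  obtain ⟨m, hm⟩ := exists_nat_one_div_lt hε
  refine ⟨c m * δ m, mul_pos (hc m) (hδ m), fun A hA => (hG m A fun g hg => ?_).trans hm.le⟩
  have h1 := lt_of_mul_lt_mul_left ((hcΛ m _ (bddAbove_indicator_one A)).trans_lt hA) (hc m).le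
  exact (Finset.single_le_sum (fun g _ => solidNorm_nonneg g (A.indicator 1)) hg).trans_lt h1

theorem bddAbove_range_sq (d : ℕ →ᵇ ℝ) : BddAbove (range fun n => d n ^ 2) := by
  refine ⟨‖d‖ ^ 2, ?_⟩
  rintro _ ⟨n, rfl⟩
  exact sq_le_sq' (abs_le.1 (d.norm_coe_le_norm n)).1 (abs_le.1 (d.norm_coe_le_norm n)).2

theorem IsControl.exists_norm_apply_le {Q : (ℕ →ᵇ ℝ) →L[ℝ] F} {Λ : (ℕ → ℝ) → ℝ}
    (hΛ : IsControl Λ)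
    (h : ∀ ε > 0, ∃ δ > 0, ∀ A : Set ℕ, Λ (A.indicator 1) < δ → solidMeas Q A ≤ ε)
    {C ε : ℝ} (hC : 0 ≤ C) (hε : 0 < ε) :
    ∃ θ > 0, ∀ d : ℕ →ᵇ ℝ, ‖d‖ ≤ C → Λ (fun n => d n ^ 2) < θ → ‖Q d‖ ≤ ε := by
  obtain ⟨δ, hδ, hA⟩ := h (ε / 2 / (C + 1)) (by positivity)
  let η : ℝ := ε / 2 / (‖Q‖ + 1)
  have hη : 0 < η := by positivity
  refine ⟨η ^ 2 * δ, by positivity, fun d hd hθ => ?_⟩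
  let A : Set ℕ := {n | η < |d n|}
  have h1 : Λ (A.indicator 1) ≤ (η ^ 2)⁻¹ * Λ (fun n => d n ^ 2) := by
    refine (hΛ.mono _ ((η ^ 2)⁻¹ • fun n => d n ^ 2) ?_ fun n => ?_).trans
      (hΛ.smul_le _ _ (bddAbove_range_sq d) (by positivity))
    · obtain ⟨B, hB⟩ := bddAbove_range_sq d
      refine ⟨(η ^ 2)⁻¹ * B, ?_⟩
      rintro _ ⟨n, rfl⟩
      exact mul_le_mul_of_nonneg_left (hB ⟨n, rfl⟩) (by positivity)
    · by_cases hn : n ∈ A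
      · have h2 : η ^ 2 ≤ d n ^ 2 := by
          rw [← sq_abs (d n)]
          exact pow_le_pow_left₀ hη.le (le_of_lt hn) 2
        simp only [hn, indicator_of_mem, Pi.one_apply, Pi.smul_apply, smul_eq_mul]
        rw [inv_mul_eq_div, one_le_div (by positivity)]
        exact h2
      · simp only [hn, not_false_eq_true, indicator_of_notMem, Pi.smul_apply, smul_eq_mul]
        positivity
  have hPA : solidMeas Q A ≤ ε / 2 / (C + 1) := by
    refine hA A (h1.trans_lt ?_)
    rwa [inv_mul_lt_iff₀ (by positivity)]
  have hdn : ∀ n, |d n| ≤ C := fun n => (d.norm_coe_le_norm n).trans hd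
  have hub : ∀ n, |A.indicator d n| ≤ C := fun n => by
    by_cases hn : n ∈ A
    · simpa [hn] using hdn n
    · simpa [hn] using hC
  let u : ℕ →ᵇ ℝ := ofNormedAddCommGroupDiscrete (A.indicator d) C hub
  have hu : ∀ n, u n = A.indicator d n := fun _ => rfl
  have h2 : ‖Q u‖ ≤ C * solidMeas Q A := norm_apply_le_mul_solidMeas Q hC hub fun n hn => by
    simp [hu, hn]
  have h3 : ‖Q (d - u)‖ ≤ ‖Q‖ * η := norm_apply_le_of_abs_le Q fun n => by
    by_cases hn : n ∈ A
    · simpa [hu, hn] using hη.le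
    · simpa [hu, hn] using not_lt.1 hn
  have h4 : C * solidMeas Q A ≤ ε / 2 := by
    have := solidMeas_nonneg Q A
    calc _ ≤ (C + 1) * (ε / 2 / (C + 1)) := by gcongr; linarith
      _ = ε / 2 := by field_simp
  have h5 : ‖Q‖ * η ≤ ε / 2 := by
    calc _ ≤ (‖Q‖ + 1) * (ε / 2 / (‖Q‖ + 1)) := by gcongr; linarith
      _ = ε / 2 := by field_simp
  calc ‖Q d‖ = ‖Q u + Q (d - u)‖ := by rw [← map_add, add_sub_cancel]
    _ ≤ _ := (norm_add_le _ _).trans (by linarith)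

theorem IsControl.parallelogram_le {Λ : (ℕ → ℝ) → ℝ} (hΛ : IsControl Λ) (x y : ℕ →ᵇ ℝ) :
    Λ (fun n => ((1 / 2 : ℝ) • x + (1 / 2 : ℝ) • y) n ^ 2) +
      Λ (fun n => ((1 / 2 : ℝ) • (x - y)) n ^ 2) ≤
      1 / 2 * (Λ (fun n => x n ^ 2) + Λ (fun n => y n ^ 2)) := by
  rw [← hΛ.add _ _ (bddAbove_range_sq _) (bddAbove_range_sq _) (fun n => sq_nonneg _)
    (fun n => sq_nonneg _), ← hΛ.add _ _ (bddAbove_range_sq _) (bddAbove_range_sq _)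
    (fun n => sq_nonneg _) (fun n => sq_nonneg _)]
  refine le_trans (le_of_eq ?_) (hΛ.smul_le (1 / 2) _ ?_ (by norm_num))
  · congr 1
    ext n
    simp
    ring
  · obtain ⟨B, hB⟩ := bddAbove_range_sq x
    obtain ⟨D, hD⟩ := bddAbove_range_sq y
    refine ⟨B + D, ?_⟩
    rintro _ ⟨n, rfl⟩
    exact add_le_add (hB ⟨n, rfl⟩) (hD ⟨n, rfl⟩)

/-- Bounded sequences have convex blocks that an exhaustive operator maps to a Cauchy
sequence. -/
theorem IsExhaustive.exists_convexHull_cauchySeq {Q : (ℕ →ᵇ ℝ) →L[ℝ] F} (hQ : IsExhaustive Q)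
    {x : ℕ → ℕ →ᵇ ℝ} {C : ℝ} (hx : ∀ n, ‖x n‖ ≤ C) :
    ∃ y : ℕ → ℕ →ᵇ ℝ, (∀ i, y i ∈ convexHull ℝ (x '' Ici i)) ∧ CauchySeq fun i => Q (y i) := by
  have hC : 0 ≤ C := (norm_nonneg _).trans (hx 0)
  obtain ⟨Λ, hΛ, hΛQ⟩ := hQ.exists_isControl
  let q : (ℕ →ᵇ ℝ) → ℝ := fun d => Λ fun n => d n ^ 2
  have hq0 : ∀ d, 0 ≤ q d := fun d => hΛ.nonneg _
  let K : ℕ → Set (ℕ →ᵇ ℝ) := fun i => convexHull ℝ (x '' Ici i)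
  have hK : Antitone K := fun i j h => convexHull_mono (image_mono (Ici_subset_Ici.2 h))
  have hxK : ∀ i, x i ∈ K i := fun i => subset_convexHull ℝ _ ⟨i, self_mem_Ici, rfl⟩
  have hKC : ∀ i, ∀ y ∈ K i, ‖y‖ ≤ C := fun i y hy => by
    have : K i ⊆ Metric.closedBall 0 C := convexHull_min
      (by rintro _ ⟨j, -, rfl⟩; simpa using hx j) (convex_closedBall _ _)
    simpa using this hy
  have hbd : ∀ i, BddBelow (q '' K i) := fun i => ⟨0, by rintro _ ⟨y, -, rfl⟩; exact hq0 y⟩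
  let d : ℕ → ℝ := fun i => sInf (q '' K i)
  have hdq : ∀ i, ∀ y ∈ K i, d i ≤ q y := fun i y hy => csInf_le (hbd i) ⟨y, hy, rfl⟩
  have hdm : Monotone d := fun i j h =>
    csInf_le_csInf (hbd i) ⟨_, x j, hxK j, rfl⟩ (image_mono (hK h))
  have hdB : BddAbove (range d) := by
    refine ⟨Λ fun _ => C ^ 2, ?_⟩
    rintro _ ⟨i, rfl⟩
    refine (hdq i _ (hxK i)).trans (hΛ.mono _ _ ⟨C ^ 2, ?_⟩ fun n => ?_)
    · rintro _ ⟨n, rfl⟩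
      exact le_rfl
    · have := abs_le.1 (((x i).norm_coe_le_norm n).trans (hx i))
      exact sq_le_sq' this.1 this.2
  choose y hyK hy using fun i : ℕ => exists_lt_of_csInf_lt (s := q '' K i)
    ⟨_, x i, hxK i, rfl⟩ (lt_add_of_pos_right (d i) (Nat.one_div_pos_of_nat (n := i)))
  choose y hyK hqy using hyK
  simp only [← hqy] at hy
  refine ⟨y, hyK, Metric.cauchySeq_iff.2 fun ε hε => ?_⟩
  obtain ⟨θ, hθ, hθQ⟩ := hΛ.exists_norm_apply_le hΛQ hC (show 0 < ε / 3 by positivity)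
  have hdc := (tendsto_atTop_ciSup hdm hdB).cauchySeq
  obtain ⟨N₁, hN₁⟩ := Metric.cauchySeq_iff.1 hdc (θ / 2) (by positivity)
  obtain ⟨N₂, hN₂⟩ := exists_nat_one_div_lt (show 0 < θ / 2 by positivity)
  have key : ∀ i j, max N₁ N₂ ≤ i → i ≤ j → dist (Q (y i)) (Q (y j)) < ε := fun i j hi hij => by
    have hi1 := (le_max_left _ _).trans hi
    have hi2 := (le_max_right _ _).trans hi
    have h1 := hΛ.parallelogram_le (y i) (y j)
    have h2 : d i ≤ q ((1 / 2 : ℝ) • y i + (1 / 2 : ℝ) • y j) := hdq i _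
      (convex_convexHull ℝ _ (hyK i) (hK hij (hyK j)) (by norm_num) (by norm_num) (by norm_num))
    have h3 := hN₁ i hi1 j (hi1.trans hij)
    rw [Real.dist_eq, abs_sub_comm] at h3
    have h3' := (abs_lt.1 h3).2
    have hinv : ∀ k ≥ N₂, 1 / ((k : ℝ) + 1) < θ / 2 := fun k hk =>
      (Nat.one_div_le_one_div hk).trans_lt hN₂
    have h4 := hinv i hi2
    have h5 := hinv j (hi2.trans hij)
    have hyi := hy i
    have hyj := hy j
    have h6 : Λ (fun n => ((1 / 2 : ℝ) • (y i - y j)) n ^ 2) < θ := by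
      simp only [q] at h2 hyi hyj
      linarith
    have h7 := hθQ _ (by
      rw [norm_smul]
      have := norm_sub_le (y i) (y j)
      have := hKC i _ (hyK i)
      have := hKC j _ (hyK j)
      norm_num
      linarith) h6
    rw [map_smul, norm_smul, map_sub] at h7
    rw [dist_eq_norm]
    norm_num at h7
    linarith
  refine ⟨max N₁ N₂, fun i hi j hj => ?_⟩
  rcases le_total i j with h | h
  · exact key i j hi h
  · rw [dist_comm]; exact key j i hj h

end Exhaustive

section Quotient

open BoundedContinuousFunction Set Filter Topology

theorem Submodule.exists_dual_apply_ne_zero {F : Type*} [NormedAddCommGroup F] [NormedSpace ℝ F]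
    (N : Submodule ℝ F) (hN : IsClosed (N : Set F)) {x : F} (hx : x ∉ N) :
    ∃ φ : F →L[ℝ] ℝ, (∀ y ∈ N, φ y = 0) ∧ φ x ≠ 0 := by
  have h0 : N.mkQL x ≠ 0 := by simpa using hx
  obtain ⟨g, -, hg⟩ := exists_dual_vector ℝ (N.mkQL x) (norm_ne_zero_iff.2 h0)
  refine ⟨g.comp N.mkQL, fun y hy => ?_, ?_⟩
  · have : N.mkQL y = 0 := by simpa using hy
    rw [ContinuousLinearMap.comp_apply, this, map_zero]
  · rw [ContinuousLinearMap.comp_apply, hg]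
    simpa using h0

/-- **Helly's theorem**: an approximate form of Goldstine's theorem for finitely many
functionals. -/
theorem exists_forall_dist_le_of_bidual {F ι : Type*} [NormedAddCommGroup F] [NormedSpace ℝ F]
    [Fintype ι] (Φ : (F →L[ℝ] ℝ) →L[ℝ] ℝ) (f : ι → F →L[ℝ] ℝ) {ε : ℝ} (hε : 0 < ε) :
    ∃ ξ : F, ‖ξ‖ ≤ ‖Φ‖ + 1 ∧ ∀ i, dist (f i ξ) (Φ (f i)) ≤ ε := by
  classical
  have hR : 0 < ‖Φ‖ + 1 := by positivity
  let T : F →L[ℝ] (ι → ℝ) := ContinuousLinearMap.pi f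
  let S : Set (ι → ℝ) := closure (T '' Metric.closedBall 0 (‖Φ‖ + 1))
  have hmem : (fun i => Φ (f i)) ∈ S := by
    by_contra hS
    obtain ⟨g, u, hgS, hgu⟩ := geometric_hahn_banach_closed_point
      (((convex_closedBall (0 : F) (‖Φ‖ + 1)).linear_image (T : F →ₗ[ℝ] ι → ℝ)).closure)
      isClosed_closure hS
    have hexp : ∀ a : ι → ℝ, g a = ∑ i, a i * g (Pi.single i 1) := fun a => by
      conv_lhs => rw [pi_eq_sum_univ' a, map_sum]
      refine Finset.sum_congr rfl fun i _ => ?_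
      rw [map_smul, smul_eq_mul]
    let h : F →L[ℝ] ℝ := g.comp T
    have hΦ : Φ h = g fun i => Φ (f i) := by
      have : h = ∑ i, g (Pi.single i 1) • f i := by
        ext ξ
        simp only [h, ContinuousLinearMap.comp_apply, hexp (T ξ), _root_.sum_apply]
        exact Finset.sum_congr rfl fun i _ => mul_comm _ _
      rw [this, map_sum, hexp]
      refine Finset.sum_congr rfl fun i _ => ?_
      rw [map_smul, smul_eq_mul, mul_comm]
    have hlt : ∀ ξ : F, ‖ξ‖ ≤ ‖Φ‖ + 1 → h ξ < u := fun ξ hξ =>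
      hgS _ (subset_closure ⟨ξ, by simpa using hξ, rfl⟩)
    have hu : 0 < u := by simpa using hlt 0 (by simpa using hR.le)
    have hh : ‖h‖ ≤ u / (‖Φ‖ + 1) := by
      refine ContinuousLinearMap.opNorm_le_of_unit_norm (by positivity) fun ξ hξ => ?_
      have h1 := hlt ((‖Φ‖ + 1) • ξ) (by rw [norm_smul, hξ, mul_one, Real.norm_of_nonneg hR.le])
      have h2 := hlt (-((‖Φ‖ + 1) • ξ))
        (by rw [norm_neg, norm_smul, hξ, mul_one, Real.norm_of_nonneg hR.le])
      rw [map_neg] at h2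
      rw [map_smul, smul_eq_mul] at h1 h2
      rw [le_div_iff₀ hR, Real.norm_eq_abs]
      nth_rw 1 [← abs_of_pos hR]
      rw [← abs_mul, abs_le]
      constructor <;> linarith
    have h3 : Φ h ≤ ‖Φ‖ * ‖h‖ := (le_abs_self _).trans (Φ.le_opNorm h)
    rw [le_div_iff₀ hR] at hh
    linarith [norm_nonneg h]
  obtain ⟨_, ⟨ξ, hξ, rfl⟩, hd⟩ := Metric.mem_closure_iff.1 hmem ε hε
  refine ⟨ξ, by simpa using hξ, fun i => ?_⟩
  rw [dist_comm]
  exact (dist_le_pi_dist _ _ i).trans hd.le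

theorem exists_linearIndependent_dual {F : Type*} [NormedAddCommGroup F] [NormedSpace ℝ F]
    (hF : ¬ FiniteDimensional ℝ F) :
    ∃ f : ℕ → F →L[ℝ] ℝ, LinearIndependent ℝ f := by
  have hD : ¬ FiniteDimensional ℝ (F →L[ℝ] ℝ) := fun h => by
    refine hF (FiniteDimensional.of_injective
      (NormedSpace.inclusionInDoubleDual ℝ F).toLinearMap ?_)
    exact (NormedSpace.inclusionInDoubleDualLi ℝ (E := F)).injective
  let b := Module.Basis.ofVectorSpace ℝ (F →L[ℝ] ℝ)
  have hinf : Infinite (Module.Basis.ofVectorSpaceIndex ℝ (F →L[ℝ] ℝ)) := by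
    by_contra hfin
    rw [not_infinite_iff_finite] at hfin
    exact hD b.finiteDimensional_of_finite
  exact ⟨b ∘ Infinite.natEmbedding _,
    b.linearIndependent.comp _ (Infinite.natEmbedding _).injective⟩

theorem exists_norm_le_one_half_norm_le_apply {F : Type*} [NormedAddCommGroup F]
    [NormedSpace ℝ F] (φ : F →L[ℝ] ℝ) :
    ∃ z : F, ‖z‖ ≤ 1 ∧ ‖φ‖ / 2 ≤ φ z := by
  rcases eq_or_ne φ 0 with rfl | hφ
  · exact ⟨0, by simp, by simp⟩
  · obtain ⟨z, hz, hφz⟩ := φ.exists_lt_apply_of_lt_opNorm (half_lt_self (norm_pos_iff.2 hφ))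
    rcases le_total 0 (φ z) with h | h
    · exact ⟨z, hz.le, by rw [Real.norm_of_nonneg h] at hφz; exact hφz.le⟩
    · exact ⟨-z, by simpa using hz.le, by rw [Real.norm_of_nonpos h] at hφz; simpa using hφz.le⟩

variable {F : Type*} [NormedAddCommGroup F] [NormedSpace ℝ F] [CompleteSpace F]

/-- In a quotient of `ℓ^∞` by an exhaustive surjection, a functional vanishing on the common
kernel of a sequence of functionals is in the norm closed span of that sequence. -/
theorem IsExhaustive.mem_closure_span {Q : (ℕ →ᵇ ℝ) →L[ℝ] F} (hQ : IsExhaustive Q)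
    (hQs : Function.Surjective Q) (f : ℕ → F →L[ℝ] ℝ) (ψ : F →L[ℝ] ℝ)
    (hψ : ∀ z, (∀ n, f n z = 0) → ψ z = 0) :
    ψ ∈ (Submodule.span ℝ (range f)).topologicalClosure := by
  by_contra hR
  obtain ⟨Φ, hΦ, hΦψ⟩ := Submodule.exists_dual_apply_ne_zero _
    (Submodule.isClosed_topologicalClosure _) hR
  have hΦf : ∀ n, Φ (f n) = 0 := fun n =>
    hΦ _ (Submodule.le_topologicalClosure _ (Submodule.subset_span ⟨n, rfl⟩))
  choose ξ hξ hξf using fun m : ℕ => exists_forall_dist_le_of_bidual Φ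
    (fun i : Option (Fin m) => i.elim ψ fun i => f i)
    (show (0 : ℝ) < 1 / (m + 1) from Nat.one_div_pos_of_nat)
  obtain ⟨C, hC, hpre⟩ := Q.exists_preimage_norm_le hQs
  choose x hQx hx using fun m => hpre (ξ m)
  obtain ⟨y, hy, hyc⟩ := hQ.exists_convexHull_cauchySeq (x := x) (C := C * (‖Φ‖ + 1)) fun m =>
    (hx m).trans (mul_le_mul_of_nonneg_left (hξ m) hC.le)
  obtain ⟨ζ, hζ⟩ := cauchySeq_tendsto_of_complete hyc
  have hval : ∀ (g : F →L[ℝ] ℝ) (i₀ : ℕ), (∀ m ≥ i₀, dist (g (ξ m)) (Φ g) ≤ 1 / ((m : ℝ) + 1)) →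
      g ζ = Φ g := fun g i₀ hg => by
    refine tendsto_nhds_unique ((g.continuous.tendsto ζ).comp hζ) ?_
    refine tendsto_iff_dist_tendsto_zero.2 (squeeze_zero' (Eventually.of_forall fun _ =>
      dist_nonneg) ?_ tendsto_one_div_add_atTop_nhds_zero_nat)
    filter_upwards [eventually_ge_atTop i₀] with i hi
    have hsub : convexHull ℝ (x '' Ici i) ⊆
        ((g.comp Q : (ℕ →ᵇ ℝ) →L[ℝ] ℝ) : (ℕ →ᵇ ℝ) →ₗ[ℝ] ℝ) ⁻¹'
          Metric.closedBall (Φ g) (1 / ((i : ℝ) + 1)) := by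
      refine convexHull_min ?_ ((convex_closedBall _ _).linear_preimage _)
      rintro _ ⟨m, hm, rfl⟩
      simp only [mem_preimage, ContinuousLinearMap.coe_coe, ContinuousLinearMap.comp_apply, hQx,
        Metric.mem_closedBall]
      exact (hg m (hi.trans hm)).trans (Nat.one_div_le_one_div hm)
    simpa using hsub (hy i)
  refine hΦψ ((hval ψ 0 fun m _ => hξf m none).symm.trans (hψ ζ fun n => ?_))
  rw [hval (f n) (n + 1) fun m hm => hξf m (some ⟨n, hm⟩), hΦf]

theorem IsExhaustive.exists_separable_quotient {Q : (ℕ →ᵇ ℝ) →L[ℝ] F} (hQ : IsExhaustive Q)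
    (hQs : Function.Surjective Q) (hF : ¬ FiniteDimensional ℝ F) :
    ∃ M : Submodule ℝ F, IsClosed (M : Set F) ∧ TopologicalSpace.SeparableSpace (F ⧸ M) ∧
      ¬ FiniteDimensional ℝ (F ⧸ M) := by
  obtain ⟨f, hf⟩ := exists_linearIndependent_dual hF
  let M : Submodule ℝ F := ⨅ n, (f n).ker
  have hM : ∀ z, z ∈ M ↔ ∀ n, f n z = 0 := fun z => by simp [M]
  have hMc : IsClosed (M : Set F) := by
    simp only [M, Submodule.coe_iInf]
    exact isClosed_iInter fun n => (f n).isClosed_ker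
  refine ⟨M, hMc, ?_, fun hfin => ?_⟩
  · obtain ⟨c, hc, hRc⟩ : TopologicalSpace.IsSeparable
        ((Submodule.span ℝ (range f)).topologicalClosure : Set (F →L[ℝ] ℝ)) := by
      rw [Submodule.topologicalClosure_coe]
      exact (countable_range f).isSeparable.span.closure
    choose z hz1 hz using exists_norm_le_one_half_norm_le_apply (F := F)
    let N : Submodule ℝ F := Submodule.span ℝ (z '' c) ⊔ M
    have hN : Dense (N : Set F) := by
      rw [Submodule.dense_iff_topologicalClosure_eq_top, Submodule.eq_top_iff']
      by_contra! h
      obtain ⟨x, hx⟩ := h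
      obtain ⟨ψ, hψN, hψx⟩ := Submodule.exists_dual_apply_ne_zero _
        N.isClosed_topologicalClosure hx
      have hψN' : ∀ y ∈ N, ψ y = 0 := fun y hy => hψN y (N.le_topologicalClosure hy)
      have hψ0 : 0 < ‖ψ‖ := norm_pos_iff.2 fun h => hψx (by simp [h])
      have hψR := hRc (hQ.mem_closure_span hQs f ψ fun y hy =>
        hψN' y (Submodule.mem_sup_right ((hM y).2 hy)))
      obtain ⟨φ, hφ, hd⟩ := Metric.mem_closure_iff.1 hψR (‖ψ‖ / 4) (by positivity)
      have h1 : ψ (z φ) = 0 :=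
        hψN' _ (Submodule.mem_sup_left (Submodule.subset_span ⟨φ, hφ, rfl⟩))
      rw [dist_comm, dist_eq_norm] at hd
      have h2 : φ (z φ) ≤ ‖φ - ψ‖ * 1 := by
        have := (le_abs_self _).trans ((φ - ψ).le_opNorm_of_le (hz1 φ))
        simpa [h1] using this
      have h3 : ‖ψ‖ ≤ ‖φ - ψ‖ + ‖φ‖ := by
        rw [norm_sub_rev]
        simpa using norm_add_le (ψ - φ) φ
      linarith [hz φ]
    have h1 : Dense (M.mkQ '' N) :=
      M.mkQ_surjective.denseRange.dense_image M.isOpenQuotientMap_mkQ.continuous hN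
    have h2 : M.mkQ '' N = Submodule.span ℝ (M.mkQ '' (z '' c)) := by
      rw [← Submodule.map_coe, Submodule.map_sup, Submodule.map_span]
      simp
    rw [h2] at h1
    rw [← TopologicalSpace.isSeparable_univ_iff, ← h1.closure_eq]
    exact ((hc.image z).image M.mkQ).isSeparable.span.closure
  · let g : ℕ → (F ⧸ M) →ₗ[ℝ] ℝ := fun n => M.liftQ (f n : F →ₗ[ℝ] ℝ) fun y hy => (hM y).1 hy n
    have h1 : LinearIndependent ℝ g := by
      refine LinearIndependent.of_comp (LinearMap.lcomp ℝ ℝ M.mkQ) ?_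
      have h2 : (LinearMap.lcomp ℝ ℝ M.mkQ) ∘ g = (ContinuousLinearMap.coeLM ℝ) ∘ f := by
        ext n y
        rfl
      rw [h2]
      exact hf.map' _ (LinearMap.ker_eq_bot.2 ContinuousLinearMap.coe_injective)
    have := h1.finite_of_isNoetherian
    exact not_finite ℕ

end Quotient

section LittleLTwo

theorem exists_hilbertBasis_l2 : Nonempty (HilbertBasis ℕ ℝ (lp (fun _ : ℕ => ℝ) 2)) :=
  ⟨HilbertBasis.ofRepr (LinearIsometryEquiv.refl ℝ _)⟩

theorem separableSpace_l2 : TopologicalSpace.SeparableSpace (lp (fun _ : ℕ => ℝ) 2) := by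
  obtain ⟨b⟩ := exists_hilbertBasis_l2
  rw [← TopologicalSpace.isSeparable_univ_iff, ← Submodule.top_coe (R := ℝ), ← b.dense_span,
    Submodule.topologicalClosure_coe]
  exact (Set.countable_range b).isSeparable.span.closure

theorem not_finiteDimensional_l2 : ¬ FiniteDimensional ℝ (lp (fun _ : ℕ => ℝ) 2) := fun _ => by
  obtain ⟨b⟩ := exists_hilbertBasis_l2
  have := b.orthonormal.linearIndependent.finite_of_isNoetherian
  exact not_finite ℕ

theorem exists_injective_linfty_l2 :
    ∃ J : lp (fun _ : ℕ => ℝ) ∞ →L[ℝ] lp (fun _ : ℕ => ℝ) 2, Function.Injective J := by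
  let P : ℕ → lp (fun _ : ℕ => ℝ) ∞ →L[ℝ] ℝ := fun n => lp.evalCLM ℝ (fun _ : ℕ => ℝ) ∞ n
  have hP : ∀ n, ‖P n‖ ≤ 1 := fun n => by
    refine ContinuousLinearMap.opNorm_le_bound _ zero_le_one fun x => ?_
    rw [one_mul]
    exact lp.norm_apply_le_norm (by norm_num) x n
  have hs : Summable fun n => (P n).smulRight ((1 / 2 : ℝ) ^ n •
      (lp.single 2 n 1 : lp (fun _ : ℕ => ℝ) 2)) := by
    refine .of_norm_bounded summable_geometric_two fun n => ?_
    rw [ContinuousLinearMap.norm_smulRight_apply, norm_smul, lp.norm_single (by norm_num)]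
    calc _ ≤ 1 * (‖(1 / 2 : ℝ) ^ n‖ * ‖(1 : ℝ)‖) := by gcongr; exact hP n
      _ = _ := by simp
  obtain ⟨J, hJ⟩ := hs
  have hval : ∀ x m, J x m = (1 / 2 : ℝ) ^ m * x m := fun x m => by
    have h1 := ((lp.evalCLM ℝ (fun _ : ℕ => ℝ) 2 m).comp
      (ContinuousLinearMap.apply ℝ (lp (fun _ : ℕ => ℝ) 2) x)).hasSum hJ
    refine h1.unique ?_
    convert hasSum_single m fun n hn => ?_ using 1
    · simp [P, lp.evalCLM, mul_comm]
    · simp [P, lp.evalCLM, hn.symm]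
  refine ⟨J, (injective_iff_map_eq_zero J).2 fun x hx => ?_⟩
  ext m
  have h1 := hval x m
  rw [hx] at h1
  simpa using h1

end LittleLTwo

open BoundedContinuousFunction in
/-- Every infinite-dimensional Banach quotient of `ℓ^∞` has a separable infinite-dimensional
Banach quotient. -/
theorem exists_separable_infinite_dimensional_quotient {F : Type} [NormedAddCommGroup F]
    [NormedSpace ℝ F] [CompleteSpace F] (hF : ¬ FiniteDimensional ℝ F) (Q : (ℕ →ᵇ ℝ) →L[ℝ] F)
    (hQ : Function.Surjective Q) :
    ∃ (E : Type) (_ : NormedAddCommGroup E) (_ : NormedSpace ℝ E) (_ : CompleteSpace E)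
      (_ : TopologicalSpace.SeparableSpace E) (q : F →L[ℝ] E),
      ¬ FiniteDimensional ℝ E ∧ Function.Surjective q := by
  by_cases h : IsExhaustive Q
  · obtain ⟨M, hM, hMs, hMd⟩ := h.exists_separable_quotient hQ hF
    exact ⟨F ⧸ M, inferInstance, inferInstance, inferInstance, hMs, M.mkQL, hMd, M.mkQ_surjective⟩
  · rw [IsExhaustive] at h
    push Not at h
    obtain ⟨δ, hδ, u, hu, hd, hQu⟩ := h
    obtain ⟨q, hq⟩ := exists_surjective_l2_of_disjoint Q hδ u hu hd hQu
    exact ⟨lp (fun _ : ℕ => ℝ) 2, inferInstance, inferInstance, inferInstance, separableSpace_l2,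
      q, not_finiteDimensional_l2, hq⟩

/-- Rosenthal's theorem: every closed subspace `Y` of `ℓ∞` is quasi-complemented: there
is a closed subspace `Z` of `ℓ∞` with `Y ⊓ Z = ⊥` and `Y + Z` dense in `ℓ∞`. -/
theorem rosenthal_quasi_complement_in_linfty
    (Y : Submodule ℝ (lp (fun _ : ℕ => ℝ) ∞))
    (hY : IsClosed (Y : Set (lp (fun _ : ℕ => ℝ) ∞))) :
    ∃ Z : Submodule ℝ (lp (fun _ : ℕ => ℝ) ∞),
      IsClosed (Z : Set (lp (fun _ : ℕ => ℝ) ∞)) ∧ Y ⊓ Z = ⊥ ∧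
      Dense ((Y ⊔ Z : Submodule ℝ (lp (fun _ : ℕ => ℝ) ∞)) : Set (lp (fun _ : ℕ => ℝ) ∞)) := by
  have hcompl : Y.ClosedComplemented → ∃ Z : Submodule ℝ (lp (fun _ : ℕ => ℝ) ∞),
      IsClosed (Z : Set (lp (fun _ : ℕ => ℝ) ∞)) ∧ Y ⊓ Z = ⊥ ∧
      Dense ((Y ⊔ Z : Submodule ℝ (lp (fun _ : ℕ => ℝ) ∞)) :
        Set (lp (fun _ : ℕ => ℝ) ∞)) := fun h => by
    obtain ⟨Z, hZ, hYZ⟩ := h.exists_isClosed_isCompl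
    refine ⟨Z, hZ, hYZ.inf_eq_bot, ?_⟩
    rw [hYZ.sup_eq_top, Submodule.top_coe]
    exact dense_univ
  by_cases hYd : FiniteDimensional ℝ Y
  · exact hcompl (.of_finiteDimensional Y)
  by_cases hF : FiniteDimensional ℝ (lp (fun _ : ℕ => ℝ) ∞ ⧸ Y)
  · exact hcompl (.of_finiteDimensional_quotient hY)
  let e := (lpBCFₗᵢ ℝ ℝ : lp (fun _ : ℕ => ℝ) ∞ ≃ₗᵢ[ℝ] _).symm
  obtain ⟨E, _, _, _, _, q, hE, hq⟩ := exists_separable_infinite_dimensional_quotient hF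
    (Y.mkQL.comp (e.toContinuousLinearEquiv : BoundedContinuousFunction ℕ ℝ →L[ℝ] _))
    (Y.mkQ_surjective.comp e.surjective)
  obtain ⟨J, hJ⟩ := exists_injective_linfty_l2
  have := separableSpace_l2
  refine exists_quasi_complement_of_separable_quotient hE J hJ Y hYd (q.comp Y.mkQL)
    (hq.comp Y.mkQ_surjective) fun y hy => ?_
  have : Y.mkQL y = 0 := by simpa using hy
  rw [ContinuousLinearMap.comp_apply, this, map_zero]
end
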